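/- arXiv:2508.09064 — 9 statements merged into one kernel-verified Lean document; each statement's English description precedes it below -/
import Mathlib

section
/- Let (X, d) be a metric space, E : X → ℝ, h > 0 and χ̄ ∈ X. Assume χ ∈ X minimizes v ↦ E(v) + d(v, χ̄)²/(2h) over X, and assume u : (0, h] → X is such that for every τ ∈ (0, h] the point u(τ) minimizes v ↦ E(v) + d(v, χ̄)²/(2τ) over X, with τ ↦ |∂E|(u(τ))² measurable on (0, h]. Then E(χ) + d(χ, χ̄)²/(2h) + (1/2)·∫₀ʰ |∂E|(u(τ))² dτ ≤ E(χ̄), as an inequality in the extended reals [0, ∞] after subtracting E(χ̄); in particular the integral is finite. (Single-step De Giorgi energy dissipation inequality for the minimizing movement scheme.) -/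
open Filter Topology MeasureTheory ENNReal

/-- The metric slope `|∂E|(u) = limsup_{v → u, v ≠ u} (E(u) − E(v))₊ / d(u,v)`,
valued in `[0, ∞]`. -/
noncomputable def metricSlope {X : Type*} [MetricSpace X] (E : X → ℝ) (u : X) : ℝ≥0∞ :=
  Filter.limsup (fun v => ENNReal.ofReal (max (E u - E v) 0 / dist u v)) (𝓝[≠] u)

/-- A minimizer `w` of `v ↦ E v + d(v,c)²/(2τ)` satisfies `|∂E|(w) ≤ d(w,c)/τ`. -/
lemma metricSlope_le_dist_div {X : Type*} [MetricSpace X] {E : X → ℝ} {τ : ℝ} (hτ : 0 < τ)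
    {w c : X} (hw : ∀ v, E w + dist w c ^ 2 / (2 * τ) ≤ E v + dist v c ^ 2 / (2 * τ)) :
    metricSlope E w ≤ ENNReal.ofReal (dist w c / τ) := by
  unfold metricSlope
  rcases eq_or_neBot (𝓝[≠] w) with hbot | hne
  · simp [hbot]
  have hlim : Tendsto (fun v => ENNReal.ofReal ((2 * dist w c + dist w v) / (2 * τ))) (𝓝[≠] w)
      (𝓝 (ENNReal.ofReal (dist w c / τ))) := by
    refine ENNReal.tendsto_ofReal (tendsto_nhdsWithin_of_tendsto_nhds ?_)
    have hcont : Continuous fun v => (2 * dist w c + dist w v) / (2 * τ) := by fun_prop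
    have hval : (2 * dist w c + dist w w) / (2 * τ) = dist w c / τ := by
      rw [dist_self, add_zero, mul_div_mul_left _ _ two_ne_zero]
    simpa only [hval] using hcont.tendsto w
  rw [← hlim.limsup_eq]
  refine limsup_le_limsup ?_
  filter_upwards [self_mem_nhdsWithin] with v hv
  have hd : 0 < dist w v := dist_pos.2 (Ne.symm hv)
  refine ENNReal.ofReal_le_ofReal ((div_le_iff₀ hd).2 (max_le ?_ (by positivity)))
  have htri : dist v c ≤ dist w v + dist w c := dist_triangle_left v c w
  calc E w - E v ≤ (dist v c ^ 2 - dist w c ^ 2) / (2 * τ) := by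
        rw [sub_div]; linarith [hw v]
    _ ≤ ((2 * dist w c + dist w v) * dist w v) / (2 * τ) := by
        gcongr
        nlinarith [pow_le_pow_left₀ dist_nonneg htri 2]
    _ = _ := by ring

/-- A function dominated a.e. by the derivative of a monotone function has lower Lebesgue
integral at most the increment of the monotone function. -/
lemma MonotoneOn.lintegral_le_ofReal_sub {g : ℝ → ℝ} {a b : ℝ} (hab : a ≤ b)
    (hg : MonotoneOn g (Set.Icc a b)) {f : ℝ → ℝ≥0∞}
    (hf : ∀ᵐ x ∂volume.restrict (Set.Ioc a b), f x ≤ ENNReal.ofReal (deriv g x)) :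
    ∫⁻ x in Set.Ioc a b, f x ≤ ENNReal.ofReal (g b - g a) := by
  obtain ⟨G, hlim, hmeas, hG⟩ := hg.exists_tendsto_deriv_liminf_lintegral_enorm_le hab
  have hle := ae_mono (Measure.restrict_mono Set.Ioc_subset_Icc_self le_rfl) hlim
  calc ∫⁻ x in Set.Ioc a b, f x
      ≤ ∫⁻ x in Set.Ioc a b, liminf (fun n => ‖G n x‖ₑ) atTop := by
        refine lintegral_mono_ae ?_
        filter_upwards [hf, hle] with x hx hGx
        rw [hGx.enorm.liminf_eq]
        exact hx.trans (Real.ofReal_le_enorm _)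
    _ ≤ ∫⁻ x in Set.Icc a b, liminf (fun n => ‖G n x‖ₑ) atTop :=
        lintegral_mono_set Set.Ioc_subset_Icc_self
    _ ≤ liminf (fun n => ∫⁻ x in Set.Icc a b, ‖G n x‖ₑ) atTop :=
        lintegral_liminf_le' fun n => (hmeas n).enorm
    _ ≤ _ := hG

/-- Single-step De Giorgi energy dissipation inequality for the minimizing movement
scheme: if `χ` minimizes `v ↦ E v + d(v,χ̄)²/(2h)` and, for every `τ ∈ (0,h]`, `u τ`
minimizes `v ↦ E v + d(v,χ̄)²/(2τ)`, then
`E χ + d(χ,χ̄)²/(2h) + (1/2)∫₀ʰ |∂E|(u τ)² dτ ≤ E χ̄`, stated as an inequality in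
`[0,∞]` after subtracting `E χ̄`; in particular the integral is finite. -/
theorem single_step_dissipation {X : Type*} [MetricSpace X]
    (E : X → ℝ) (h : ℝ) (hh : 0 < h) (χbar χ : X) (u : ℝ → X)
    (hχ : ∀ v : X, E χ + dist χ χbar ^ 2 / (2 * h) ≤ E v + dist v χbar ^ 2 / (2 * h))
    (hu : ∀ τ : ℝ, τ ∈ Set.Ioc (0 : ℝ) h →
      ∀ v : X, E (u τ) + dist (u τ) χbar ^ 2 / (2 * τ) ≤ E v + dist v χbar ^ 2 / (2 * τ))
    (hmeas : AEMeasurable (fun τ : ℝ => (metricSlope E (u τ)) ^ 2)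
      (volume.restrict (Set.Ioc (0 : ℝ) h))) :
    (1 / 2 : ℝ≥0∞) * ∫⁻ τ in Set.Ioc (0 : ℝ) h, (metricSlope E (u τ)) ^ 2 ∂volume
      ≤ ENNReal.ofReal (E χbar - (E χ + dist χ χbar ^ 2 / (2 * h))) := by
  let g : ℝ → ℝ := fun τ =>
    if 0 < τ then -(E (u τ) + dist (u τ) χbar ^ 2 / (2 * τ)) else -E χbar
  have hg_pos {τ : ℝ} (hτ : 0 < τ) : g τ = -(E (u τ) + dist (u τ) χbar ^ 2 / (2 * τ)) :=
    if_pos hτ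
  have hg_zero : g 0 = -E χbar := if_neg (lt_irrefl 0)
  have hincr {s t : ℝ} (hs : 0 < s) (hst : s ≤ t) (ht : t ≤ h) :
      dist (u s) χbar ^ 2 / (2 * s) - dist (u s) χbar ^ 2 / (2 * t) ≤ g t - g s := by
    rw [hg_pos hs, hg_pos (hs.trans_le hst)]
    linarith [hu t ⟨hs.trans_le hst, ht⟩ (u s)]
  have hmono : MonotoneOn g (Set.Icc 0 h) := by
    intro s hs t ht hst
    rcases hs.1.eq_or_lt with rfl | hs0
    · rcases ht.1.eq_or_lt with rfl | ht0
      · rfl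
      · have := hu t ⟨ht0, ht.2⟩ χbar
        rw [dist_self] at this
        rw [hg_zero, hg_pos ht0]
        norm_num at this ⊢
        linarith
    · have hdiff := hincr hs0 hst ht.2
      have : dist (u s) χbar ^ 2 / (2 * t) ≤ dist (u s) χbar ^ 2 / (2 * s) := by gcongr
      linarith
  have hderiv {s : ℝ} (hs : s ∈ Set.Ioo 0 h) (hd : DifferentiableAt ℝ g s) :
      dist (u s) χbar ^ 2 / (2 * s ^ 2) ≤ deriv g s := by
    have hs0 : 0 < s := hs.1
    have hslope : Tendsto (slope g s) (𝓝[>] s) (𝓝 (deriv g s)) :=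
      (hasDerivAt_iff_tendsto_slope_left_right.1 hd.hasDerivAt).2
    have hlow : Tendsto (fun t => dist (u s) χbar ^ 2 / (2 * s * t)) (𝓝[>] s)
        (𝓝 (dist (u s) χbar ^ 2 / (2 * s ^ 2))) := by
      have hcont : ContinuousAt (fun t => dist (u s) χbar ^ 2 / (2 * s * t)) s :=
        continuousAt_const.div (by fun_prop) (by positivity)
      have hval : dist (u s) χbar ^ 2 / (2 * s * s) = dist (u s) χbar ^ 2 / (2 * s ^ 2) := by
        ring
      exact tendsto_nhdsWithin_of_tendsto_nhds (hval ▸ hcont.tendsto)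
    refine le_of_tendsto_of_tendsto hlow hslope ?_
    filter_upwards [Ioc_mem_nhdsGT hs.2] with t ht
    have ht0 : 0 < t := hs0.trans ht.1
    rw [slope_def_field, le_div_iff₀ (sub_pos.2 ht.1)]
    refine le_trans (le_of_eq ?_) (hincr hs0 ht.1.le ht.2)
    field_simp
  have hbound : ∀ᵐ τ ∂volume.restrict (Set.Ioc 0 h),
      (1 / 2 : ℝ≥0∞) * metricSlope E (u τ) ^ 2 ≤ ENNReal.ofReal (deriv g τ) := by
    rw [← restrict_Ioo_eq_restrict_Ioc, ae_restrict_iff' measurableSet_Ioo]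
    filter_upwards [hmono.ae_differentiableWithinAt_of_mem] with τ hd hτ
    have hdiff : DifferentiableAt ℝ g τ :=
      (hd (Set.Ioo_subset_Icc_self hτ)).differentiableAt (Icc_mem_nhds hτ.1 hτ.2)
    calc (1 / 2 : ℝ≥0∞) * metricSlope E (u τ) ^ 2
        ≤ ENNReal.ofReal (1 / 2) * ENNReal.ofReal (dist (u τ) χbar / τ) ^ 2 := by
          gcongr
          · rw [ENNReal.ofReal_div_of_pos two_pos]
            simp
          · exact metricSlope_le_dist_div hτ.1 (hu τ (Set.Ioo_subset_Ioc_self hτ))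
      _ = ENNReal.ofReal (dist (u τ) χbar ^ 2 / (2 * τ ^ 2)) := by
          rw [← ENNReal.ofReal_pow (div_nonneg dist_nonneg hτ.1.le),
            ← ENNReal.ofReal_mul (by norm_num)]
          congr 1
          ring
      _ ≤ _ := ENNReal.ofReal_le_ofReal (hderiv hτ hdiff)
  rw [← lintegral_const_mul' _ _ (by simp)]
  refine (hmono.lintegral_le_ofReal_sub hh.le hbound).trans (ENNReal.ofReal_le_ofReal ?_)
  rw [hg_zero, hg_pos hh]
  linarith [hχ (u h)]
end

section
/- Let (X, d) be a metric space, h > 0, χ₀ ∈ X, and for each integer ℓ ≥ 1 let Eₗ : X → ℝ. Assume for each ℓ ≥ 1: χₗ ∈ X minimizes v ↦ Eₗ(v) + d(v, χₗ₋₁)²/(2h) over X, and uₗ : (0, h] → X is such that for every τ ∈ (0, h] the point uₗ(τ) minimizes v ↦ Eₗ(v) + d(v, χₗ₋₁)²/(2τ) over X, with τ ↦ |∂Eₗ|(uₗ(τ))² measurable. Assume moreover there is E : X → ℝ satisfying E(χₗ) − E(χₗ₋₁) = Eₗ(χₗ) − Eₗ(χₗ₋₁) for every ℓ ≥ 1.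 Then for every L ∈ ℕ: E(χ_L) + Σ_{ℓ=1}^{L} [ d(χₗ, χₗ₋₁)²/(2h) + (1/2)·∫₀ʰ |∂Eₗ|(uₗ(τ))² dτ ] ≤ E(χ₀). (Telescoped discrete energy dissipation inequality for iteration-dependent energies.) -/
open Filter Topology MeasureTheory ENNReal

/-- The resolvent of `E` with step `τ` bounds the slope by the difference quotient `d / τ`. -/
theorem metricSlope_le_of_isMinimizer {X : Type*} [MetricSpace X] {E : X → ℝ} {w x : X} {τ : ℝ}
    (hτ : 0 < τ)
    (hmin : ∀ v, E x + dist x w ^ 2 / (2 * τ) ≤ E v + dist v w ^ 2 / (2 * τ)) :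
    metricSlope E x ≤ ENNReal.ofReal (dist x w / τ) := by
  rcases (𝓝[≠] x).eq_or_neBot with hbot | hne
  · simp [metricSlope, hbot]
  have hle : ∀ᶠ v in 𝓝[≠] x, ENNReal.ofReal (max (E x - E v) 0 / dist x v) ≤
      ENNReal.ofReal ((2 * dist x w + dist x v) / (2 * τ)) := by
    filter_upwards [self_mem_nhdsWithin] with v hv
    have hd : 0 < dist x v := dist_pos.2 (Ne.symm hv)
    have hnn : 0 ≤ dist x w := dist_nonneg
    have htri : dist v w ≤ dist x v + dist x w := dist_triangle_left v w x
    have hsq : dist v w ^ 2 ≤ (dist x v + dist x w) ^ 2 := by gcongr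
    apply ENNReal.ofReal_le_ofReal
    rw [div_le_iff₀ hd]
    refine max_le ?_ (by positivity)
    calc E x - E v ≤ (dist v w ^ 2 - dist x w ^ 2) / (2 * τ) := by
          rw [sub_div]; linarith [hmin v]
      _ ≤ ((2 * dist x w + dist x v) * dist x v) / (2 * τ) := by
          gcongr; nlinarith
      _ = (2 * dist x w + dist x v) / (2 * τ) * dist x v := by ring
  have hlim : Tendsto (fun v => ENNReal.ofReal ((2 * dist x w + dist x v) / (2 * τ)))
      (𝓝[≠] x) (𝓝 (ENNReal.ofReal (dist x w / τ))) := by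
    have hc : Continuous fun v => ENNReal.ofReal ((2 * dist x w + dist x v) / (2 * τ)) :=
      ENNReal.continuous_ofReal.comp (by fun_prop)
    have := (hc.tendsto x).mono_left (nhdsWithin_le_nhds (s := {x}ᶜ))
    rwa [dist_self, add_zero, mul_div_mul_left _ _ two_ne_zero] at this
  exact (limsup_le_limsup hle).trans_eq hlim.limsup_eq

/-- Integrated form of the dissipation along the variational interpolation of a minimizing
movement step. -/
theorem lintegral_metricSlope_sq_le {X : Type*} [MetricSpace X] {E : X → ℝ} {w : X} {h : ℝ}
    (hh : 0 < h) {u : ℝ → X}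
    (hu : ∀ τ ∈ Set.Ioc 0 h, ∀ v,
      E (u τ) + dist (u τ) w ^ 2 / (2 * τ) ≤ E v + dist v w ^ 2 / (2 * τ)) :
    ∫⁻ τ in Set.Ioc 0 h, metricSlope E (u τ) ^ 2 ≤
      ENNReal.ofReal (2 * (E w - (E (u h) + dist (u h) w ^ 2 / (2 * h)))) := by
  set G : ℝ → ℝ := fun τ => if 0 < τ then -(E (u τ) + dist (u τ) w ^ 2 / (2 * τ)) else -E w
    with hG
  have hG_pos : ∀ {τ}, 0 < τ → G τ = -(E (u τ) + dist (u τ) w ^ 2 / (2 * τ)) := fun hτ => if_pos hτ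
  have hG_zero : G 0 = -E w := if_neg (lt_irrefl 0)
  have hmono : MonotoneOn G (Set.uIcc 0 h) := by
    rw [Set.uIcc_of_le hh.le]
    rintro s ⟨hs, -⟩ t ⟨-, ht⟩ hst
    rcases hs.eq_or_lt with rfl | hs
    · rcases hst.eq_or_lt with rfl | ht'
      · rfl
      · rw [hG_zero, hG_pos ht']
        simpa using hu t ⟨ht', ht⟩ w
    · have ht' := hs.trans_le hst
      rw [hG_pos hs, hG_pos ht', neg_le_neg_iff]
      refine (hu t ⟨ht', ht⟩ (u s)).trans ?_
      gcongr
  have hderiv : ∀ s ∈ Set.Ioo 0 h, DifferentiableAt ℝ G s →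
      deriv G s = dist (u s) w ^ 2 / (2 * s ^ 2) := by
    rintro s ⟨hs, hsh⟩ hd
    have hmin : IsLocalMin (fun t => G t + dist (u s) w ^ 2 / 2 * t⁻¹) s := by
      filter_upwards [Ioo_mem_nhds hs hsh] with t ht
      have h1 := hu t ⟨ht.1, ht.2.le⟩ (u s)
      have e : ∀ r : ℝ, dist (u s) w ^ 2 / 2 * r⁻¹ = dist (u s) w ^ 2 / (2 * r) := fun r => by
        rw [← div_eq_mul_inv, div_div]
      rw [hG_pos hs, hG_pos ht.1, e, e]
      linarith
    have hz := hmin.hasDerivAt_eq_zero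
      (hd.hasDerivAt.add ((hasDerivAt_inv hs.ne').const_mul (dist (u s) w ^ 2 / 2)))
    have : deriv G s = dist (u s) w ^ 2 / 2 * (s ^ 2)⁻¹ := by linarith
    rw [this, ← div_eq_mul_inv, div_div]
  have hdiff : ∀ᵐ s, s ∈ Set.Ioo 0 h → DifferentiableAt ℝ G s := by
    filter_upwards [hmono.ae_differentiableWithinAt_of_mem] with s hs hs'
    rw [Set.uIcc_of_le hh.le] at hs
    exact (hs (Set.Ioo_subset_Icc_self hs')).differentiableAt (Icc_mem_nhds hs'.1 hs'.2)
  have hae : ∀ᵐ s ∂volume.restrict (Set.Ioc 0 h), s ∈ Set.Ioo 0 h ∧ DifferentiableAt ℝ G s := by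
    rw [← Measure.restrict_congr_set Ioo_ae_eq_Ioc, ae_restrict_iff' measurableSet_Ioo]
    filter_upwards [hdiff] with s hs hs' using ⟨hs', hs hs'⟩
  have hint : IntegrableOn (fun s => 2 * deriv G s) (Set.Ioc 0 h) :=
    ((intervalIntegrable_iff_integrableOn_Ioc_of_le hh.le).1
      hmono.intervalIntegrable_deriv).const_mul 2
  calc ∫⁻ τ in Set.Ioc 0 h, metricSlope E (u τ) ^ 2
      ≤ ∫⁻ τ in Set.Ioc 0 h, ENNReal.ofReal (2 * deriv G τ) := by
        refine lintegral_mono_ae ?_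
        filter_upwards [hae] with s ⟨hs, hd⟩
        have hs0 : s ≠ 0 := hs.1.ne'
        calc metricSlope E (u s) ^ 2 ≤ ENNReal.ofReal (dist (u s) w / s) ^ 2 := by
              gcongr
              exact metricSlope_le_of_isMinimizer hs.1 (hu s ⟨hs.1, hs.2.le⟩)
          _ = ENNReal.ofReal (2 * deriv G s) := by
              rw [← ENNReal.ofReal_pow (div_nonneg dist_nonneg hs.1.le), hderiv s hs hd]
              congr 1
              field_simp
    _ = ENNReal.ofReal (∫ τ in Set.Ioc 0 h, 2 * deriv G τ) := by
        refine (ofReal_integral_eq_lintegral_ofReal hint ?_).symm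
        filter_upwards [hae] with s ⟨hs, hd⟩
        rw [hderiv s hs hd]
        exact mul_nonneg zero_le_two (by positivity)
    _ ≤ ENNReal.ofReal (2 * (E w - (E (u h) + dist (u h) w ^ 2 / (2 * h)))) := by
        apply ENNReal.ofReal_le_ofReal
        have hle : G 0 ≤ G h := hmono Set.left_mem_uIcc Set.right_mem_uIcc hh.le
        have hmem := hmono.intervalIntegral_deriv_mem_uIcc
        rw [Set.uIcc_of_le (sub_nonneg.2 hle), intervalIntegral.integral_of_le hh.le,
          hG_pos hh, hG_zero] at hmem
        rw [integral_const_mul]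
        linarith [hmem.2]

/-- Discrete energy dissipation inequality for a single minimizing movement step. -/
theorem minimizingMovement_dissipation {X : Type*} [MetricSpace X] {E : X → ℝ} {w x : X} {h : ℝ}
    (hh : 0 < h) {u : ℝ → X}
    (hx : ∀ v, E x + dist x w ^ 2 / (2 * h) ≤ E v + dist v w ^ 2 / (2 * h))
    (hu : ∀ τ ∈ Set.Ioc 0 h, ∀ v,
      E (u τ) + dist (u τ) w ^ 2 / (2 * τ) ≤ E v + dist v w ^ 2 / (2 * τ)) :
    ENNReal.ofReal (dist x w ^ 2 / (2 * h)) +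
        (1 / 2 : ℝ≥0∞) * ∫⁻ τ in Set.Ioc 0 h, metricSlope E (u τ) ^ 2 ≤
      ENNReal.ofReal (E w - E x) := by
  have hw : E x + dist x w ^ 2 / (2 * h) ≤ E w := by simpa using hx w
  have hxu := hx (u h)
  have hhalf : (1 / 2 : ℝ≥0∞) = ENNReal.ofReal (1 / 2) := by
    rw [ENNReal.ofReal_div_of_pos two_pos]; simp
  calc _ ≤ ENNReal.ofReal (dist x w ^ 2 / (2 * h)) + (1 / 2 : ℝ≥0∞) *
          ENNReal.ofReal (2 * (E w - (E x + dist x w ^ 2 / (2 * h)))) := by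
        gcongr
        exact (lintegral_metricSlope_sq_le hh hu).trans
          (ENNReal.ofReal_le_ofReal (by linarith))
    _ = ENNReal.ofReal (E w - E x) := by
        rw [hhalf, ← ENNReal.ofReal_mul (by norm_num),
          ← ENNReal.ofReal_add (by positivity) (by linarith)]
        congr 1
        ring

/-- Telescoped discrete energy dissipation inequality for iteration-dependent energies:
if for each `ℓ ≥ 1` the point `χ ℓ` minimizes `v ↦ Eseq ℓ v + d(v, χ (ℓ-1))²/(2h)`, the
variational interpolation `uℓ` minimizes `v ↦ Eseq ℓ v + d(v, χ (ℓ-1))²/(2τ)` for each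
`τ ∈ (0,h]`, and `E (χ ℓ) − E (χ (ℓ-1)) = Eseq ℓ (χ ℓ) − Eseq ℓ (χ (ℓ-1))`, then for
every `L`,
`E (χ L) + Σ_{ℓ=1}^L [ d(χ ℓ, χ (ℓ-1))²/(2h) + (1/2)∫₀ʰ |∂(Eseq ℓ)|(uℓ τ)² dτ ] ≤ E (χ 0)`,
stated as an inequality in `[0,∞]` after subtracting `E (χ L)`. -/
theorem telescoped_dissipation {X : Type*} [MetricSpace X]
    (h : ℝ) (hh : 0 < h) (Eseq : ℕ → X → ℝ) (E : X → ℝ) (χ : ℕ → X) (u : ℕ → ℝ → X)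
    (hχ : ∀ ℓ : ℕ, 1 ≤ ℓ → ∀ v : X,
      Eseq ℓ (χ ℓ) + dist (χ ℓ) (χ (ℓ - 1)) ^ 2 / (2 * h)
        ≤ Eseq ℓ v + dist v (χ (ℓ - 1)) ^ 2 / (2 * h))
    (hu : ∀ ℓ : ℕ, 1 ≤ ℓ → ∀ τ : ℝ, τ ∈ Set.Ioc (0 : ℝ) h → ∀ v : X,
      Eseq ℓ (u ℓ τ) + dist (u ℓ τ) (χ (ℓ - 1)) ^ 2 / (2 * τ)
        ≤ Eseq ℓ v + dist v (χ (ℓ - 1)) ^ 2 / (2 * τ))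
    (hmeas : ∀ ℓ : ℕ, 1 ≤ ℓ →
      AEMeasurable (fun τ : ℝ => (metricSlope (Eseq ℓ) (u ℓ τ)) ^ 2)
        (volume.restrict (Set.Ioc (0 : ℝ) h)))
    (hE : ∀ ℓ : ℕ, 1 ≤ ℓ →
      E (χ ℓ) - E (χ (ℓ - 1)) = Eseq ℓ (χ ℓ) - Eseq ℓ (χ (ℓ - 1))) :
    ∀ L : ℕ,
      ∑ ℓ ∈ Finset.Icc 1 L,
          (ENNReal.ofReal (dist (χ ℓ) (χ (ℓ - 1)) ^ 2 / (2 * h))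
            + (1 / 2 : ℝ≥0∞) *
              ∫⁻ τ in Set.Ioc (0 : ℝ) h, (metricSlope (Eseq ℓ) (u ℓ τ)) ^ 2 ∂volume)
        ≤ ENNReal.ofReal (E (χ 0) - E (χ L)) := by
  have hstep : ∀ n, E (χ (n + 1)) ≤ E (χ n) := fun n => by
    have h1 := hχ (n + 1) n.succ_pos (χ n)
    have h2 := hE (n + 1) n.succ_pos
    simp only [Nat.add_sub_cancel, dist_self] at h1 h2
    have h3 : 0 ≤ dist (χ (n + 1)) (χ n) ^ 2 / (2 * h) := by positivity
    norm_num at h1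
    linarith
  intro L
  induction L with
  | zero => simp
  | succ n ih =>
    rw [Finset.sum_Icc_succ_top (Nat.le_add_left 1 n)]
    have hdiss := minimizingMovement_dissipation hh (hχ (n + 1) n.succ_pos) (hu (n + 1) n.succ_pos)
    have hEn := hE (n + 1) n.succ_pos
    refine (add_le_add ih hdiss).trans_eq ?_
    simp only [Nat.add_sub_cancel] at hEn ⊢
    have h0 : E (χ n) ≤ E (χ 0) := antitone_nat_of_succ_le (f := fun n => E (χ n)) hstep n.zero_le
    rw [← ENNReal.ofReal_add (by linarith) (by linarith [hstep n])]
    congr 1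
    linarith
end

section
/- Let (X, d) be a metric space, h > 0, χ₀ ∈ X, and for each integer ℓ ≥ 1 let Eₗ : X → ℝ. Assume for each ℓ ≥ 1: χₗ ∈ X minimizes v ↦ Eₗ(v) + d(v, χₗ₋₁)²/(2h) over X, and uₗ : (0, h] → X is such that for every τ ∈ (0, h] the point uₗ(τ) minimizes v ↦ Eₗ(v) + d(v, χₗ₋₁)²/(2τ) over X. Assume there is E : X → ℝ with E(χₗ) − E(χₗ₋₁) = Eₗ(χₗ) − Eₗ(χₗ₋₁) for every ℓ ≥ 1 and with E(χ_L) ≥ 0 for every L ∈ ℕ. Then Σ_{ℓ=1}^{∞} (1/(2h²))·∫₀ʰ d(uₗ(τ), χₗ₋₁)² dτ ≤ E(χ₀). -/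
open Filter Topology MeasureTheory ENNReal

/-- The distance to the base point of a minimizer of the penalized energy is monotone in the
step size. -/
lemma dist_sq_le_of_penalized_minimizers {X : Type*} [MetricSpace X] {F : X → ℝ} {x y z : X}
    {τ h : ℝ} (hτ : 0 < τ) (hτh : τ < h)
    (hz : F z + dist z x ^ 2 / (2 * τ) ≤ F y + dist y x ^ 2 / (2 * τ))
    (hy : F y + dist y x ^ 2 / (2 * h) ≤ F z + dist z x ^ 2 / (2 * h)) :
    dist z x ^ 2 ≤ dist y x ^ 2 := by
  have hinv : 1 / (2 * h) < 1 / (2 * τ) :=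
    one_div_lt_one_div_of_lt (by positivity) (by linarith)
  rw [div_eq_mul_one_div (dist z x ^ 2), div_eq_mul_one_div (dist y x ^ 2)] at hz hy
  by_contra! hlt
  nlinarith [mul_pos (sub_pos.2 hlt) (sub_pos.2 hinv)]

/-- In one step of the scheme, the averaged squared distance of the variational interpolation to
the base point is bounded by the drop of the energy. -/
lemma lintegral_interpolation_le_energy_drop {X : Type*} [MetricSpace X] {F : X → ℝ} {x y : X}
    {u : ℝ → X} {h : ℝ} (hh : 0 < h)
    (hy : ∀ v, F y + dist y x ^ 2 / (2 * h) ≤ F v + dist v x ^ 2 / (2 * h))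
    (hu : ∀ τ ∈ Set.Ioc (0 : ℝ) h, ∀ v,
      F (u τ) + dist (u τ) x ^ 2 / (2 * τ) ≤ F v + dist v x ^ 2 / (2 * τ)) :
    ENNReal.ofReal (1 / (2 * h ^ 2)) *
        ∫⁻ τ in Set.Ioc (0 : ℝ) h, ENNReal.ofReal (dist (u τ) x ^ 2)
      ≤ ENNReal.ofReal (F x - F y) := by
  have hbound : ∫⁻ τ in Set.Ioc (0 : ℝ) h, ENNReal.ofReal (dist (u τ) x ^ 2)
      ≤ ENNReal.ofReal (dist y x ^ 2 * h) := by
    rw [← setLIntegral_congr Ioo_ae_eq_Ioc]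
    calc ∫⁻ τ in Set.Ioo (0 : ℝ) h, ENNReal.ofReal (dist (u τ) x ^ 2)
        ≤ ∫⁻ _ in Set.Ioo (0 : ℝ) h, ENNReal.ofReal (dist y x ^ 2) :=
          setLIntegral_mono measurable_const fun τ hτ => ENNReal.ofReal_le_ofReal <|
            dist_sq_le_of_penalized_minimizers hτ.1 hτ.2
              (hu τ (Set.Ioo_subset_Ioc_self hτ) y) (hy (u τ))
      _ = ENNReal.ofReal (dist y x ^ 2 * h) := by
          rw [setLIntegral_const, Real.volume_Ioo, sub_zero, ENNReal.ofReal_mul (sq_nonneg _)]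
  refine (mul_le_mul_right hbound _).trans ?_
  rw [← ENNReal.ofReal_mul (by positivity)]
  apply ENNReal.ofReal_le_ofReal
  have hx := hy x
  rw [dist_self] at hx
  have hscale : 1 / (2 * h ^ 2) * (dist y x ^ 2 * h) = dist y x ^ 2 / (2 * h) := by
    field_simp
  rw [hscale]
  norm_num at hx
  linarith

/-- Bound on the total squared distance between the variational interpolation and the
iterates of a minimizing movement scheme with iteration-dependent energies:
`Σ_{ℓ=1}^∞ (1/(2h²)) ∫₀ʰ d(uₗ(τ), χ_{ℓ-1})² dτ ≤ E (χ 0)`. -/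
theorem interpolation_distance_bound {X : Type*} [MetricSpace X]
    (h : ℝ) (hh : 0 < h) (Eseq : ℕ → X → ℝ) (E : X → ℝ) (χ : ℕ → X) (u : ℕ → ℝ → X)
    (hχ : ∀ ℓ : ℕ, 1 ≤ ℓ → ∀ v : X,
      Eseq ℓ (χ ℓ) + dist (χ ℓ) (χ (ℓ - 1)) ^ 2 / (2 * h)
        ≤ Eseq ℓ v + dist v (χ (ℓ - 1)) ^ 2 / (2 * h))
    (hu : ∀ ℓ : ℕ, 1 ≤ ℓ → ∀ τ : ℝ, τ ∈ Set.Ioc (0 : ℝ) h → ∀ v : X,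
      Eseq ℓ (u ℓ τ) + dist (u ℓ τ) (χ (ℓ - 1)) ^ 2 / (2 * τ)
        ≤ Eseq ℓ v + dist v (χ (ℓ - 1)) ^ 2 / (2 * τ))
    (hE : ∀ ℓ : ℕ, 1 ≤ ℓ →
      E (χ ℓ) - E (χ (ℓ - 1)) = Eseq ℓ (χ ℓ) - Eseq ℓ (χ (ℓ - 1)))
    (hE0 : ∀ L : ℕ, 0 ≤ E (χ L)) :
    ∑' ℓ : ℕ,
        ENNReal.ofReal (1 / (2 * h ^ 2)) *
          ∫⁻ τ in Set.Ioc (0 : ℝ) h,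
            ENNReal.ofReal (dist (u (ℓ + 1) τ) (χ ℓ) ^ 2) ∂volume
      ≤ ENNReal.ofReal (E (χ 0)) := by
  have hstep : ∀ ℓ : ℕ, ENNReal.ofReal (1 / (2 * h ^ 2)) *
      ∫⁻ τ in Set.Ioc (0 : ℝ) h, ENNReal.ofReal (dist (u (ℓ + 1) τ) (χ ℓ) ^ 2)
        ≤ ENNReal.ofReal (E (χ ℓ) - E (χ (ℓ + 1))) := by
    intro ℓ
    have hdrop := hE (ℓ + 1) (by omega)
    rw [Nat.add_sub_cancel] at hdrop
    rw [show E (χ ℓ) - E (χ (ℓ + 1)) = Eseq (ℓ + 1) (χ ℓ) - Eseq (ℓ + 1) (χ (ℓ + 1)) by linarith]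
    exact lintegral_interpolation_le_energy_drop hh (hχ (ℓ + 1) (by omega))
      (hu (ℓ + 1) (by omega))
  have hanti : ∀ ℓ : ℕ, 0 ≤ E (χ ℓ) - E (χ (ℓ + 1)) := by
    intro ℓ
    have hdrop := hE (ℓ + 1) (by omega)
    have hmin := hχ (ℓ + 1) (by omega) (χ ℓ)
    rw [Nat.add_sub_cancel] at hdrop hmin
    rw [dist_self] at hmin
    have : 0 ≤ dist (χ (ℓ + 1)) (χ ℓ) ^ 2 / (2 * h) := by positivity
    norm_num at hmin
    linarith
  refine ENNReal.tsum_le_of_sum_range_le fun L => ?_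
  refine (Finset.sum_le_sum fun ℓ _ => hstep ℓ).trans ?_
  rw [← ENNReal.ofReal_sum_of_nonneg fun ℓ _ => hanti ℓ,
    Finset.sum_range_sub' fun ℓ => E (χ ℓ)]
  exact ENNReal.ofReal_le_ofReal (by linarith [hE0 L])
end

section
/- For every integer d ≥ 1, every linear map A : ℝᵈ → ℝᵈ and every unit vector n ∈ ℝᵈ, ∫_{ℝᵈ} G₁(z) · ⟨A z, z⟩ · max(⟨n, z⟩, 0) dz = (2/√π) · (⟨A n, n⟩ + trace A). -/
open MeasureTheory
open scoped RealInnerProductSpace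
lemma integrable_gaussian_mul_pow (m : ℕ) :
    Integrable fun x : ℝ => Real.exp (-x ^ 2 / 4) * x ^ m := by
  have h := integrable_rpow_mul_exp_neg_mul_sq (b := 1 / 4) (by norm_num) (s := m)
    (by have : (0 : ℝ) ≤ m := m.cast_nonneg
        linarith)
  refine h.congr (Filter.Eventually.of_forall fun x => ?_)
  simp only [Real.rpow_natCast]
  rw [mul_comm]; congr 2; ring

lemma gaussian_mul_pow_mul_max_eq_indicator (m : ℕ) :
    (fun x : ℝ => Real.exp (-x ^ 2 / 4) * x ^ m * max x 0) =
      (Set.Ioi 0).indicator fun x => Real.exp (-x ^ 2 / 4) * x ^ (m + 1) := by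
  ext x
  by_cases hx : 0 < x
  · simp [hx, max_eq_left hx.le, pow_succ, mul_assoc]
  · simp [hx, max_eq_right (not_lt.mp hx)]

lemma integrable_gaussian_mul_pow_mul_max (m : ℕ) :
    Integrable fun x : ℝ => Real.exp (-x ^ 2 / 4) * x ^ m * max x 0 := by
  rw [gaussian_mul_pow_mul_max_eq_indicator]
  exact (integrable_gaussian_mul_pow _).indicator measurableSet_Ioi

lemma integral_Ioi_gaussian_mul_pow (m : ℕ) :
    ∫ x in Set.Ioi (0 : ℝ), Real.exp (-x ^ 2 / 4) * x ^ m =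
      2 ^ m * Real.Gamma ((m + 1) / 2) := by
  have hm : (0 : ℝ) ≤ m := m.cast_nonneg
  have h := integral_rpow_mul_exp_neg_mul_rpow (p := 2) (q := m) (b := 1 / 4)
    (by norm_num) (by linarith) (by norm_num)
  have h4 : (1 / 4 : ℝ) ^ (-((m : ℝ) + 1) / 2) = 2 ^ (m + 1) := by
    rw [show (1 / 4 : ℝ) = 2 ^ (-2 : ℝ) by norm_num [Real.rpow_neg],
      ← Real.rpow_mul (by norm_num), ← Real.rpow_natCast]
    congr 1; push_cast; ring
  rw [h4] at h
  rw [show (2 : ℝ) ^ m = 2 ^ (m + 1) * (1 / 2) by ring, ← h]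
  refine integral_congr_ae (Filter.Eventually.of_forall fun x => ?_)
  simp only [Real.rpow_natCast, Real.rpow_ofNat]
  rw [mul_comm]; congr 2; ring

lemma integral_gaussian_mul_pow_mul_max (m : ℕ) :
    ∫ x : ℝ, Real.exp (-x ^ 2 / 4) * x ^ m * max x 0 =
      2 ^ (m + 1) * Real.Gamma ((m + 2) / 2) := by
  rw [gaussian_mul_pow_mul_max_eq_indicator, integral_indicator measurableSet_Ioi,
    integral_Ioi_gaussian_mul_pow]
  push_cast; ring_nf

lemma integral_gaussian_mul_pow_of_even {m : ℕ} (hm : Even m) :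
    ∫ x : ℝ, Real.exp (-x ^ 2 / 4) * x ^ m = 2 ^ (m + 1) * Real.Gamma ((m + 1) / 2) := by
  have h := integral_comp_abs (f := fun x : ℝ => Real.exp (-x ^ 2 / 4) * x ^ m)
  simp only [sq_abs, hm.pow_abs] at h
  rw [h, integral_Ioi_gaussian_mul_pow]; ring

lemma integral_gaussian_mul_self : ∫ x : ℝ, Real.exp (-x ^ 2 / 4) * x = 0 := by
  have h := integral_neg_eq_self (fun x : ℝ => Real.exp (-x ^ 2 / 4) * x) volume
  simp only [neg_sq, mul_neg, integral_neg] at h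
  linarith

lemma integral_gaussian_mul_ite (p q : Prop) [Decidable p] [Decidable q] :
    ∫ x : ℝ, Real.exp (-x ^ 2 / 4) * x ^ (if p then 2 else 0) * (if q then max x 0 else 1) =
      (2 * √Real.pi) * ((if q then 1 / √Real.pi else 1) *
        if p then (if q then 4 else 2) else 1) := by
  have h0 : √Real.pi ≠ 0 := by positivity
  have e0 := integral_gaussian_mul_pow_of_even (m := 0) (by simp)
  have e2 := integral_gaussian_mul_pow_of_even (m := 2) (by simp)
  have m0 := integral_gaussian_mul_pow_mul_max 0
  have m2 := integral_gaussian_mul_pow_mul_max 2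
  have g : Real.Gamma (3 / 2) = √Real.pi / 2 := by
    rw [show (3 / 2 : ℝ) = 1 / 2 + 1 by norm_num, Real.Gamma_add_one (by norm_num),
      Real.Gamma_one_half_eq]; ring
  norm_num [Real.Gamma_one_half_eq, g, Real.Gamma_two] at e0 e2 m0 m2
  by_cases hp : p <;> by_cases hq : q <;> simp [hp, hq, e0, e2, m0, m2] <;> field_simp <;> norm_num

section coordinates

variable {ι : Type*} [Fintype ι] [DecidableEq ι]

lemma gaussian_mul_mul_mul_max_eq_prod (l i j : ι) (x : ι → ℝ) :
    Real.exp (-(∑ k, x k ^ 2) / 4) * (x i * x j) * max (x l) 0 =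
      ∏ k, Real.exp (-x k ^ 2 / 4) *
        x k ^ ((if k = i then 1 else 0) + (if k = j then 1 else 0)) *
          (if k = l then max (x k) 0 else 1) := by
  simp only [pow_add, Finset.prod_mul_distrib, ← Real.exp_sum, ← Finset.sum_div,
    Finset.sum_neg_distrib]
  simp [pow_ite]

lemma integrable_gaussian_mul_mul_mul_max (l i j : ι) :
    Integrable fun x : ι → ℝ =>
      Real.exp (-(∑ k, x k ^ 2) / 4) * (x i * x j) * max (x l) 0 := by
  simp only [gaussian_mul_mul_mul_max_eq_prod]
  refine Integrable.fintype_prod (f := fun k t => Real.exp (-t ^ 2 / 4) *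
    t ^ ((if k = i then 1 else 0) + (if k = j then 1 else 0)) *
      (if k = l then max t 0 else 1)) fun k => ?_
  by_cases hk : k = l
  · simpa only [hk, if_true] using integrable_gaussian_mul_pow_mul_max _
  · simpa only [hk, if_false, mul_one] using integrable_gaussian_mul_pow _

lemma integral_gaussian_mul_mul_mul_max (l i j : ι) :
    ∫ x : ι → ℝ, Real.exp (-(∑ k, x k ^ 2) / 4) * (x i * x j) * max (x l) 0 =
      if i = j then (2 * √Real.pi) ^ Fintype.card ι * (1 / √Real.pi * if i = l then 4 else 2)
      else 0 := by
  simp only [gaussian_mul_mul_mul_max_eq_prod]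
  rw [integral_fintype_prod_volume_eq_prod (fun k t => Real.exp (-t ^ 2 / 4) *
    t ^ ((if k = i then 1 else 0) + (if k = j then 1 else 0)) *
      (if k = l then max t 0 else 1))]
  by_cases hij : i = j
  · subst hij
    have h (k : ι) : (if k = i then 1 else 0) + (if k = i then 1 else 0) =
        if k = i then 2 else 0 := by split_ifs <;> rfl
    simp only [h, integral_gaussian_mul_ite,
      Finset.prod_mul_distrib, Finset.prod_ite_eq', Finset.mem_univ, if_true,
      Finset.prod_const, Finset.card_univ, mul_pow]
  · rw [if_neg hij]
    obtain ⟨k, hk, hkl⟩ : ∃ k,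
        (if k = i then 1 else 0) + (if k = j then 1 else 0) = 1 ∧ k ≠ l := by
      by_cases hil : i = l
      · exact ⟨j, by simp [Ne.symm hij], fun h => hij (hil.trans h.symm)⟩
      · exact ⟨i, by simp [hij], hil⟩
    refine Finset.prod_eq_zero (Finset.mem_univ k) ?_
    simpa [hk, hkl] using integral_gaussian_mul_self

end coordinates

/-- For every linear map `A : ℝᵈ → ℝᵈ` and unit vector `n ∈ ℝᵈ`,
`∫_{ℝᵈ} G₁(z) ⟨Az, z⟩ (⟨n,z⟩)₊ dz = (2/√π)(⟨An, n⟩ + trace A)`, where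
`G₁(z) = (4π)^{-d/2} exp(-‖z‖²/4)` is the Gaussian kernel. -/
theorem gaussian_halfspace_quadratic_moment (d : ℕ) (hd : 1 ≤ d)
    (A : EuclideanSpace ℝ (Fin d) →ₗ[ℝ] EuclideanSpace ℝ (Fin d))
    (n : EuclideanSpace ℝ (Fin d)) (hn : ‖n‖ = 1) :
    ∫ z : EuclideanSpace ℝ (Fin d),
        (4 * Real.pi) ^ (-(d : ℝ) / 2) * Real.exp (-‖z‖ ^ 2 / 4) *
          ⟪A z, z⟫ * max ⟪n, z⟫ 0
      = 2 / Real.sqrt Real.pi *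
          (⟪A n, n⟫ + LinearMap.trace ℝ (EuclideanSpace ℝ (Fin d)) A) := by
  obtain ⟨b, hb⟩ := Orthonormal.exists_orthonormalBasis_extension_of_card_eq (𝕜 := ℝ)
    (ι := Fin d) (E := EuclideanSpace ℝ (Fin d)) (by simp) (v := fun _ => n)
    (s := {⟨0, hd⟩}) (by simp [orthonormal_subsingleton_iff, hn])
  set l : Fin d := ⟨0, hd⟩
  replace hb : b l = n := hb l rfl
  have hz (x : Fin d → ℝ) : b.repr.symm (WithLp.toLp 2 x) = ∑ k, x k • b k :=
    b.sum_repr_symm _ |>.symm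
  have hmp : MeasurePreserving fun x : Fin d → ℝ => b.repr.symm (WithLp.toLp 2 x) :=
    b.measurePreserving_repr_symm.comp (PiLp.volume_preserving_toLp (Fin d))
  have hme : MeasurableEmbedding fun x : Fin d → ℝ => b.repr.symm (WithLp.toLp 2 x) :=
    b.measurableEquiv.symm.measurableEmbedding.comp
      (MeasurableEquiv.toLp 2 (Fin d → ℝ)).measurableEmbedding
  rw [← hmp.integral_comp hme]
  have hint (x : Fin d → ℝ) :
      (4 * Real.pi) ^ (-(d : ℝ) / 2) * Real.exp (-‖b.repr.symm (WithLp.toLp 2 x)‖ ^ 2 / 4) *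
          ⟪A (b.repr.symm (WithLp.toLp 2 x)), b.repr.symm (WithLp.toLp 2 x)⟫ *
          max ⟪n, b.repr.symm (WithLp.toLp 2 x)⟫ 0 =
        ∑ i, ∑ j, (4 * Real.pi) ^ (-(d : ℝ) / 2) * ⟪A (b i), b j⟫ *
          (Real.exp (-(∑ k, x k ^ 2) / 4) * (x i * x j) * max (x l) 0) := by
    have hnorm : ‖b.repr.symm (WithLp.toLp 2 x)‖ ^ 2 = ∑ k, x k ^ 2 := by
      simp [EuclideanSpace.norm_sq_eq]
    have hl : ⟪n, b.repr.symm (WithLp.toLp 2 x)⟫ = x l := by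
      rw [← hb, ← b.repr_apply_apply]; simp
    rw [hnorm, hl, hz]
    simp only [map_sum, map_smul, sum_inner, inner_sum, real_inner_smul_left,
      real_inner_smul_right, Finset.mul_sum, Finset.sum_mul]
    rw [Finset.sum_comm]
    refine Finset.sum_congr rfl fun i _ => Finset.sum_congr rfl fun j _ => ?_
    ring
  have hc : (4 * Real.pi) ^ (-(d : ℝ) / 2) * (2 * √Real.pi) ^ d = 1 := by
    have h4 : 2 * √Real.pi = (4 * Real.pi) ^ (1 / 2 : ℝ) := by
      rw [← Real.sqrt_eq_rpow, Real.sqrt_mul (by norm_num),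
        show (4 : ℝ) = 2 ^ 2 by norm_num, Real.sqrt_sq (by norm_num)]
    rw [h4, ← Real.rpow_mul_natCast (by positivity), ← Real.rpow_add (by positivity)]
    ring_nf
    simp
  simp only [hint]
  rw [integral_finsetSum _ fun i _ => integrable_finsetSum _ fun j _ =>
    (integrable_gaussian_mul_mul_mul_max l i j).const_mul _]
  have hi (i : Fin d) := integral_finsetSum (μ := (volume : Measure (Fin d → ℝ))) Finset.univ
    fun j _ => (integrable_gaussian_mul_mul_mul_max l i j).const_mul
      ((4 * Real.pi) ^ (-(d : ℝ) / 2) * ⟪A (b i), b j⟫)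
  simp only [hi, integral_const_mul, integral_gaussian_mul_mul_mul_max, mul_ite, mul_zero,
    Finset.sum_ite_eq, Finset.mem_univ, if_true, Fintype.card_fin]
  rw [LinearMap.trace_eq_sum_inner A b, ← hb, mul_add, Finset.mul_sum]
  have hterm (i : Fin d) :
      (if i = l then (4 * Real.pi) ^ (-(d : ℝ) / 2) * ⟪A (b i), b i⟫ *
          ((2 * √Real.pi) ^ d * (1 / √Real.pi * 4))
        else (4 * Real.pi) ^ (-(d : ℝ) / 2) * ⟪A (b i), b i⟫ *
          ((2 * √Real.pi) ^ d * (1 / √Real.pi * 2))) =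
      (if i = l then 2 / √Real.pi * ⟪A (b i), b i⟫ else 0) +
        2 / √Real.pi * ⟪b i, A (b i)⟫ := by
    rw [real_inner_comm (A (b i)) (b i)]
    split_ifs
    · linear_combination (4 / √Real.pi * ⟪A (b i), b i⟫) * hc
    · linear_combination (2 / √Real.pi * ⟪A (b i), b i⟫) * hc
  simp only [hterm, Finset.sum_add_distrib, Finset.sum_ite_eq', Finset.mem_univ, if_true]
end

section
/- For every integer d ≥ 1, every vector ξ ∈ ℝᵈ and every unit vector n ∈ ℝᵈ, ∫_{ℝᵈ} G₁(z) · ⟨ξ, z⟩² · max(⟨n, z⟩, 0) dz = (2/√π) · (⟨ξ, n⟩² + ‖ξ‖²). -/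
open MeasureTheory
open scoped RealInnerProductSpace

open ProbabilityTheory

lemma gaussianPDFReal_zero_two (t : ℝ) :
    gaussianPDFReal 0 2 t = (Real.sqrt (4 * Real.pi))⁻¹ * Real.exp (-t ^ 2 / 4) := by
  simp only [gaussianPDFReal, sub_zero, NNReal.coe_ofNat]
  rw [show 2 * Real.pi * 2 = 4 * Real.pi by ring]
  norm_num

lemma gaussianPDFReal_zero_two_mul_max (t : ℝ) (m : ℕ) :
    gaussianPDFReal 0 2 t * t ^ m * max t 0 =
      (Set.Ioi 0).indicator (fun t ↦ gaussianPDFReal 0 2 t * t ^ (m + 1)) t := by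
  by_cases ht : 0 < t
  · simp [ht, ht.le, pow_succ, mul_assoc]
  · simp [ht, not_lt.1 ht]

lemma integrable_gaussianPDFReal_zero_two_mul_pow (m : ℕ) :
    Integrable fun t ↦ gaussianPDFReal 0 2 t * t ^ m := by
  have h := (integrable_rpow_mul_exp_neg_mul_sq (b := 1 / 4) (by norm_num) (s := m)
    (by linarith [m.cast_nonneg (α := ℝ)])).const_mul (Real.sqrt (4 * Real.pi))⁻¹
  refine h.congr (.of_forall fun t ↦ ?_)
  simp only [gaussianPDFReal_zero_two, Real.rpow_natCast]
  ring_nf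

lemma integrable_gaussianPDFReal_zero_two_mul_pow_mul_max (m : ℕ) :
    Integrable fun t ↦ gaussianPDFReal 0 2 t * t ^ m * max t 0 := by
  simp_rw [gaussianPDFReal_zero_two_mul_max]
  exact (integrable_gaussianPDFReal_zero_two_mul_pow _).indicator measurableSet_Ioi

lemma integral_gaussianPDFReal_zero_two_mul_pow_mul_max (m : ℕ) :
    ∫ t, gaussianPDFReal 0 2 t * t ^ m * max t 0 =
      (Real.sqrt (4 * Real.pi))⁻¹ *
        ((1 / 4 : ℝ) ^ (-((m : ℝ) + 2) / 2) * (1 / 2) * Real.Gamma (((m : ℝ) + 2) / 2)) := by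
  simp_rw [gaussianPDFReal_zero_two_mul_max]
  rw [integral_indicator measurableSet_Ioi]
  have h := integral_rpow_mul_exp_neg_mul_rpow (p := 2) (q := (m + 1 : ℕ)) (b := 1 / 4)
    (by norm_num) (by linarith [(m + 1).cast_nonneg (α := ℝ)]) (by norm_num)
  rw [show ((m : ℝ) + 2) = ((m + 1 : ℕ) : ℝ) + 1 by push_cast; ring, ← h,
    ← integral_const_mul]
  refine integral_congr_ae (.of_forall fun t ↦ ?_)
  simp only [gaussianPDFReal_zero_two, Real.rpow_natCast, Real.rpow_ofNat]
  ring_nf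

lemma sqrt_four_mul_pi : Real.sqrt (4 * Real.pi) = 2 * Real.sqrt Real.pi := by
  rw [Real.sqrt_mul (by norm_num), show (4 : ℝ) = 2 ^ 2 by norm_num, Real.sqrt_sq (by norm_num)]

lemma integral_gaussianPDFReal_zero_two_mul_max :
    ∫ t, gaussianPDFReal 0 2 t * max t 0 = 1 / Real.sqrt Real.pi := by
  have h := integral_gaussianPDFReal_zero_two_mul_pow_mul_max 0
  simp only [pow_zero, mul_one] at h
  rw [h, sqrt_four_mul_pi]
  norm_num [Real.rpow_neg]
  ring

lemma integral_gaussianPDFReal_zero_two_mul_sq_mul_max :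
    ∫ t, gaussianPDFReal 0 2 t * t ^ 2 * max t 0 = 4 / Real.sqrt Real.pi := by
  rw [integral_gaussianPDFReal_zero_two_mul_pow_mul_max 2, sqrt_four_mul_pi]
  norm_num [Real.rpow_neg]
  ring

lemma integral_gaussianPDFReal_zero_two_mul_self :
    ∫ t, gaussianPDFReal 0 2 t * t = 0 := by
  have h := integral_gaussianReal_eq_integral_smul (μ := 0) (v := 2) (f := fun t : ℝ ↦ t)
    (by norm_num)
  simpa [integral_id_gaussianReal] using h.symm

lemma integral_gaussianPDFReal_zero_two_mul_sq :
    ∫ t, gaussianPDFReal 0 2 t * t ^ 2 = 2 := by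
  have h := integral_gaussianReal_eq_integral_smul (μ := 0) (v := 2) (f := fun t : ℝ ↦ t ^ 2)
    (by norm_num)
  have hv := variance_of_integral_eq_zero (μ := gaussianReal 0 2) (X := fun t : ℝ ↦ t)
    measurable_id'.aemeasurable integral_id_gaussianReal
  rw [variance_fun_id_gaussianReal, h] at hv
  simpa using hv.symm

section Coordinates

variable {ι : Type*} [DecidableEq ι]

/-- The factor in coordinate `k` of `∏ₖ g(xₖ) · xᵢ · xⱼ · max(x_l, 0)`, `g` the Gaussian density of
variance `2`. -/
noncomputable def gaussianMomentFactor (l i j k : ι) (t : ℝ) : ℝ :=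
  gaussianPDFReal 0 2 t * t ^ ((if k = i then 1 else 0) + (if k = j then 1 else 0)) *
    if k = l then max t 0 else 1

lemma integrable_gaussianMomentFactor (l i j k : ι) :
    Integrable (gaussianMomentFactor l i j k) := by
  unfold gaussianMomentFactor
  by_cases hk : k = l
  · simpa only [hk, if_true] using integrable_gaussianPDFReal_zero_two_mul_pow_mul_max _
  · simpa only [hk, if_false, mul_one] using integrable_gaussianPDFReal_zero_two_mul_pow _

lemma prod_gaussianMomentFactor [Fintype ι] (l i j : ι) (x : ι → ℝ) :
    ∏ k, gaussianMomentFactor l i j k (x k) =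
      (∏ k, gaussianPDFReal 0 2 (x k)) * (x i * x j) * max (x l) 0 := by
  simp only [gaussianMomentFactor, Finset.prod_mul_distrib, pow_add, pow_ite, pow_one, pow_zero,
    Finset.prod_ite_eq', Finset.mem_univ, if_true]

lemma integral_gaussianMomentFactor_of_ne {l i j k : ι} (hi : k ≠ i) (hj : k ≠ j) (hl : k ≠ l) :
    ∫ t, gaussianMomentFactor l i j k t = 1 := by
  simp [gaussianMomentFactor, hi, hj, hl, integral_gaussianPDFReal_eq_one]

lemma prod_integral_gaussianMomentFactor [Fintype ι] (l i j : ι) :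
    ∏ k, ∫ t, gaussianMomentFactor l i j k t =
      if i = j then 2 / Real.sqrt Real.pi * (1 + if i = l then 1 else 0) else 0 := by
  by_cases hij : i = j
  · subst hij
    by_cases hil : i = l
    · subst hil
      rw [Finset.prod_eq_single i
        (fun k _ hk ↦ integral_gaussianMomentFactor_of_ne hk hk hk) (by simp)]
      simp [gaussianMomentFactor, integral_gaussianPDFReal_zero_two_mul_sq_mul_max]
      ring
    · rw [Finset.prod_eq_mul i l hil
        (fun k _ hk ↦ integral_gaussianMomentFactor_of_ne hk.1 hk.1 hk.2) (by simp) (by simp)]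
      simp [gaussianMomentFactor, hil, Ne.symm hil, integral_gaussianPDFReal_zero_two_mul_sq,
        integral_gaussianPDFReal_zero_two_mul_max, div_eq_mul_inv]
  · rw [if_neg hij]
    by_cases hil : i = l
    · have hjl : j ≠ l := fun h ↦ hij (hil.trans h.symm)
      refine Finset.prod_eq_zero (Finset.mem_univ j) ?_
      simp [gaussianMomentFactor, hjl, Ne.symm hij, integral_gaussianPDFReal_zero_two_mul_self]
    · refine Finset.prod_eq_zero (Finset.mem_univ i) ?_
      simp [gaussianMomentFactor, hil, hij, integral_gaussianPDFReal_zero_two_mul_self]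

lemma integral_prod_gaussianPDFReal_mul_sum_sq_mul_max [Fintype ι] (l : ι) (a : ι → ℝ) :
    ∫ x : ι → ℝ, (∏ k, gaussianPDFReal 0 2 (x k)) * (∑ i, a i * x i) ^ 2 * max (x l) 0 =
      2 / Real.sqrt Real.pi * (a l ^ 2 + ∑ i, a i ^ 2) := by
  have hexp (x : ι → ℝ) :
      (∏ k, gaussianPDFReal 0 2 (x k)) * (∑ i, a i * x i) ^ 2 * max (x l) 0 =
        ∑ i, ∑ j, a i * a j * ∏ k, gaussianMomentFactor l i j k (x k) := by
    simp_rw [prod_gaussianMomentFactor, sq, Finset.sum_mul_sum, Finset.mul_sum, Finset.sum_mul]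
    refine Finset.sum_congr rfl fun i _ ↦ Finset.sum_congr rfl fun j _ ↦ by ring
  have hint (i j : ι) : Integrable fun x : ι → ℝ ↦
      a i * a j * ∏ k, gaussianMomentFactor l i j k (x k) :=
    (Integrable.fintype_prod fun k ↦ integrable_gaussianMomentFactor l i j k).const_mul _
  simp_rw [hexp]
  rw [integral_finsetSum _ fun i _ ↦ integrable_finsetSum _ fun j _ ↦ hint i j]
  simp_rw [integral_finsetSum _ fun j _ ↦ hint _ j, integral_const_mul,
    integral_fintype_prod_volume_eq_prod, prod_integral_gaussianMomentFactor]
  simp only [mul_ite, mul_zero, Finset.sum_ite_eq, Finset.mem_univ, if_true, mul_add, mul_one,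
    Finset.sum_add_distrib, Finset.sum_ite_eq', Finset.mul_sum]
  rw [add_comm]
  congr 1
  · ring
  · exact Finset.sum_congr rfl fun i _ ↦ by ring

end Coordinates

lemma prod_gaussianPDFReal_zero_two {ι : Type*} [Fintype ι] (x : ι → ℝ) :
    ∏ k, gaussianPDFReal 0 2 (x k) =
      (4 * Real.pi) ^ (-(Fintype.card ι : ℝ) / 2) * Real.exp (-(∑ k, x k ^ 2) / 4) := by
  have hpi : (0 : ℝ) ≤ 4 * Real.pi := by positivity
  simp_rw [gaussianPDFReal_zero_two, Finset.prod_mul_distrib, ← Real.exp_sum]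
  congr 1
  · rw [Finset.prod_const, Finset.card_univ, Real.sqrt_eq_rpow, ← Real.rpow_neg hpi,
      ← Real.rpow_natCast, ← Real.rpow_mul hpi]
    ring_nf
  · rw [← Finset.sum_div, Finset.sum_neg_distrib]

lemma exists_orthonormalBasis_apply_eq {ι E : Type*} [Fintype ι] [NormedAddCommGroup E]
    [InnerProductSpace ℝ E] [FiniteDimensional ℝ E] (h : Module.finrank ℝ E = Fintype.card ι)
    (i : ι) {v : E} (hv : ‖v‖ = 1) : ∃ b : OrthonormalBasis ι ℝ E, b i = v := by
  obtain ⟨b, hb⟩ := Orthonormal.exists_orthonormalBasis_extension_of_card_eq (𝕜 := ℝ) h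
    (v := fun _ ↦ v) (s := {i}) ⟨fun _ ↦ hv, fun j k hjk ↦ (hjk (Subsingleton.elim j k)).elim⟩
  exact ⟨b, hb i rfl⟩

/-- For every vector `ξ ∈ ℝᵈ` and unit vector `n ∈ ℝᵈ`,
`∫_{ℝᵈ} G₁(z) ⟨ξ, z⟩² (⟨n,z⟩)₊ dz = (2/√π)(⟨ξ, n⟩² + ‖ξ‖²)`, where
`G₁(z) = (4π)^{-d/2} exp(-‖z‖²/4)` is the Gaussian kernel. -/
theorem gaussian_halfspace_square_moment (d : ℕ) (hd : 1 ≤ d)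
    (ξ n : EuclideanSpace ℝ (Fin d)) (hn : ‖n‖ = 1) :
    ∫ z : EuclideanSpace ℝ (Fin d),
        (4 * Real.pi) ^ (-(d : ℝ) / 2) * Real.exp (-‖z‖ ^ 2 / 4) *
          ⟪ξ, z⟫ ^ 2 * max ⟪n, z⟫ 0
      = 2 / Real.sqrt Real.pi * (⟪ξ, n⟫ ^ 2 + ‖ξ‖ ^ 2) := by
  obtain ⟨b, hb⟩ := exists_orthonormalBasis_apply_eq (by simp) (⟨0, hd⟩ : Fin d) hn
  have hmp := (PiLp.volume_preserving_ofLp (Fin d)).comp b.measurePreserving_repr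
  have hemb : MeasurableEmbedding (WithLp.ofLp ∘ b.repr) :=
    (b.measurableEquiv.trans (MeasurableEquiv.toLp 2 (Fin d → ℝ)).symm).measurableEmbedding
  rw [← b.sum_sq_norm_inner_right ξ, ← hb, real_inner_comm]
  have key := integral_prod_gaussianPDFReal_mul_sum_sq_mul_max (⟨0, hd⟩ : Fin d)
    (fun i ↦ ⟪b i, ξ⟫)
  simp only [Real.norm_eq_abs, sq_abs]
  rw [← key, ← hmp.integral_comp hemb]
  refine integral_congr_ae (.of_forall fun z ↦ ?_)
  simp only [prod_gaussianPDFReal_zero_two, Function.comp_apply, b.repr_apply_apply,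
    Fintype.card_fin]
  have h1 : ∑ k, ⟪b k, z⟫ ^ 2 = ‖z‖ ^ 2 := by
    simpa using b.sum_sq_norm_inner_right z
  have h2 : ∑ k, ⟪b k, ξ⟫ * ⟪b k, z⟫ = ⟪ξ, z⟫ := by
    rw [← b.sum_inner_mul_inner ξ z]
    exact Finset.sum_congr rfl fun k _ ↦ by rw [real_inner_comm ξ]
  rw [h1, h2]
end

section
/- For every measurable u : M → [0, 1]: ∫_M |u(x) − (Ku)(x)| dμ(x) ≤ 2 · ∫_M ∫_M k(x, y) · u(x) · (1 − u(y)) dμ(y) dμ(x). -/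
open MeasureTheory ENNReal

/-- For a symmetric Markov kernel density `k` on a σ-finite measure space and a
measurable `u : M → [0,1]`,
`∫ |u − Ku| dμ ≤ 2 ∫∫ k(x,y) u(x) (1 − u(y)) dμ(y) dμ(x)`, where
`(Ku)(x) = ∫ k(x,y) u(y) dμ(y)`. -/
theorem l1_kernel_difference_bound {M : Type*} [MeasurableSpace M]
    (μ : Measure M) [SigmaFinite μ]
    (k : M → M → ℝ) (hk_meas : Measurable (Function.uncurry k))
    (hk_nonneg : ∀ x y, 0 ≤ k x y) (hk_symm : ∀ x y, k x y = k y x)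
    (hk_markov : ∀ᵐ x ∂μ, ∫⁻ y, ENNReal.ofReal (k x y) ∂μ = 1)
    (u : M → ℝ) (hu : Measurable u) (hu0 : ∀ x, 0 ≤ u x) (hu1 : ∀ x, u x ≤ 1) :
    ∫⁻ x, ENNReal.ofReal |u x - ∫ y, k x y * u y ∂μ| ∂μ
      ≤ 2 * ∫⁻ x, ∫⁻ y, ENNReal.ofReal (k x y * u x * (1 - u y)) ∂μ ∂μ := by
  have hmeas : Measurable fun p : M × M =>
      ENNReal.ofReal (k p.1 p.2 * u p.1 * (1 - u p.2)) := by
    have : Measurable fun p : M × M => k p.1 p.2 := hk_meas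
    fun_prop
  have hmeas_swap : Measurable fun p : M × M =>
      ENNReal.ofReal (k p.1 p.2 * u p.2 * (1 - u p.1)) := by
    have : Measurable fun p : M × M => k p.1 p.2 := hk_meas
    fun_prop
  have hswap : ∫⁻ x, ∫⁻ y, ENNReal.ofReal (k x y * u y * (1 - u x)) ∂μ ∂μ
      = ∫⁻ x, ∫⁻ y, ENNReal.ofReal (k x y * u x * (1 - u y)) ∂μ ∂μ := by
    rw [lintegral_lintegral_swap hmeas_swap.aemeasurable]
    simp_rw [fun x y => hk_symm y x]
  calc ∫⁻ x, ENNReal.ofReal |u x - ∫ y, k x y * u y ∂μ| ∂μ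
      ≤ ∫⁻ x, ((∫⁻ y, ENNReal.ofReal (k x y * u x * (1 - u y)) ∂μ)
          + ∫⁻ y, ENNReal.ofReal (k x y * u y * (1 - u x)) ∂μ) ∂μ := by
        refine lintegral_mono_ae ?_
        filter_upwards [hk_markov] with x hx
        have hkx : Measurable (k x) := hk_meas.of_uncurry_left
        have hint : Integrable (k x) μ :=
          (lintegral_ofReal_ne_top_iff_integrable hkx.aestronglyMeasurable
            (Filter.Eventually.of_forall (hk_nonneg x))).1 (by simp [hx])
        have hone : ∫ y, k x y ∂μ = 1 := by
          rw [integral_eq_lintegral_of_nonneg_ae (Filter.Eventually.of_forall (hk_nonneg x))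
            hkx.aestronglyMeasurable, hx, ENNReal.toReal_one]
        have hint_mul : Integrable (fun y => k x y * u y) μ :=
          hint.mul_bdd (c := 1) hu.aestronglyMeasurable
            (Filter.Eventually.of_forall fun y => by
              rw [Real.norm_eq_abs, abs_of_nonneg (hu0 y)]; exact hu1 y)
        have hdiff : u x - ∫ y, k x y * u y ∂μ = ∫ y, (k x y * u x - k x y * u y) ∂μ := by
          rw [integral_sub (hint.mul_const _) hint_mul, integral_mul_const, hone, one_mul]
        rw [hdiff, ← Real.norm_eq_abs, ofReal_norm,
          ← lintegral_add_left (f := fun y => ENNReal.ofReal (k x y * u x * (1 - u y))) (by fun_prop)]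
        refine (enorm_integral_le_lintegral_enorm _).trans (lintegral_mono fun y => ?_)
        have h1 : 0 ≤ k x y * u x * (1 - u y) :=
          mul_nonneg (mul_nonneg (hk_nonneg x y) (hu0 x)) (sub_nonneg.2 (hu1 y))
        have h2 : 0 ≤ k x y * u y * (1 - u x) :=
          mul_nonneg (mul_nonneg (hk_nonneg x y) (hu0 y)) (sub_nonneg.2 (hu1 x))
        rw [← ofReal_norm, Real.norm_eq_abs, ← ENNReal.ofReal_add h1 h2]
        exact ENNReal.ofReal_le_ofReal (abs_le.2 ⟨by linarith, by linarith⟩)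
    _ = 2 * ∫⁻ x, ∫⁻ y, ENNReal.ofReal (k x y * u x * (1 - u y)) ∂μ ∂μ := by
        rw [lintegral_add_left hmeas.lintegral_prod_right', hswap, two_mul]
end

section
/- Let d ≥ 1 be an integer and κ ≥ 0. Let R : ℝ → (d × d real matrices) be continuous with |R(t)_{ij}| ≤ κ for all t ∈ [0, 1] and all indices i, j, and let J : ℝ → (d × d real matrices) be twice continuously differentiable (entrywise) with J″(t) = −R(t)·J(t) for all t ∈ [0, 1]. Assume either (J(0), J′(0)) = (0, I_d) or (J(0), J′(0)) = (I_d, 0). Then ‖J(1) − I_d‖_F² ≤ d³ · κ² · e^{1 + dκ}. -/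
open Matrix

/-- Second-order Grönwall estimate: if `‖j''‖ ≤ a ‖j‖` on `[0, 1]` and one of `j 0`, `j' 0`
vanishes while the other has norm at most `c`, then `j 1` is close to `j 0 + j' 0`. -/
theorem norm_sub_add_le_of_norm_second_deriv_le {E : Type*} [NormedAddCommGroup E]
    [NormedSpace ℝ E] {j v w : ℝ → E} {a c : ℝ} (ha : 0 ≤ a)
    (hj : ∀ t, HasDerivAt j (v t) t) (hv : ∀ t, HasDerivAt v (w t) t)
    (hw : ∀ t ∈ Set.Icc (0 : ℝ) 1, ‖w t‖ ≤ a * ‖j t‖)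
    (h0 : (j 0 = 0 ∧ ‖v 0‖ ≤ c) ∨ (‖j 0‖ ≤ c ∧ v 0 = 0)) :
    ‖j 1 - (j 0 + v 0)‖ ≤ a * c * Real.exp (√a) := by
  have hc : 0 ≤ c := by
    rcases h0 with h | h
    exacts [(norm_nonneg _).trans h.2, (norm_nonneg _).trans h.1]
  set s := √a
  have hs : 0 ≤ s := Real.sqrt_nonneg a
  have hss : s * s = a := Real.mul_self_sqrt ha
  have hz (t : ℝ) : HasDerivAt (fun t => (s • j t, v t)) (s • v t, w t) t :=
    ((hj t).const_smul s).prodMk (hv t)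
  have hgron (δ : ℝ) (hδ : ‖(s • j 0, v 0)‖ ≤ δ) (t : ℝ) (ht : t ∈ Set.Icc (0 : ℝ) 1) :
      ‖(s • j t, v t)‖ ≤ δ * Real.exp s := by
    have hδ0 : 0 ≤ δ := (norm_nonneg _).trans hδ
    have key := norm_le_gronwallBound_of_norm_deriv_right_le (K := s) (ε := 0) (a := 0) (b := 1)
      (f := fun t => (s • j t, v t)) (f' := fun t => (s • v t, w t))
      (fun t _ => (hz t).continuousAt.continuousWithinAt)
      (fun t _ => (hz t).hasDerivWithinAt) hδ
      (fun t ht => by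
        have h := hw t ⟨ht.1, ht.2.le⟩
        have h1 := norm_fst_le (s • j t, v t)
        have h2 := norm_snd_le (s • j t, v t)
        simp only [norm_smul, Real.norm_of_nonneg hs] at h1 h2
        rw [add_zero, Prod.norm_mk, max_le_iff, norm_smul, Real.norm_of_nonneg hs]
        refine ⟨by gcongr, h.trans ?_⟩
        rw [← hss, mul_assoc]
        gcongr) t ht
    rw [gronwallBound_ε0] at key
    refine key.trans ?_
    gcongr
    nlinarith [ht.2]
  have haj (t : ℝ) (ht : t ∈ Set.Icc (0 : ℝ) 1) : a * ‖j t‖ ≤ a * c * Real.exp s := by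
    rw [mul_assoc]
    rcases h0 with ⟨hj0, hv0⟩ | ⟨hj0, hv0⟩
    · have hbound := hgron c (by simpa [hj0, Prod.norm_mk] using hv0)
      have h := (convex_Icc (0 : ℝ) 1).norm_image_sub_le_of_norm_hasDerivWithin_le
        (fun t _ => (hj t).hasDerivWithinAt)
        (fun t ht => (norm_snd_le (s • j t, v t)).trans (hbound t ht))
        (Set.left_mem_Icc.2 zero_le_one) ht
      rw [hj0, sub_zero, sub_zero, Real.norm_of_nonneg ht.1] at h
      gcongr
      exact h.trans (mul_le_of_le_one_right (by positivity) ht.2)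
    · have h := (norm_fst_le (s • j t, v t)).trans
        (hgron (s * c) (by
          simpa [hv0, Prod.norm_mk, norm_smul, abs_of_nonneg hs, hc, hs, mul_nonneg]
            using mul_le_mul_of_nonneg_left hj0 hs) t ht)
      simp only [norm_smul, Real.norm_of_nonneg hs] at h
      rw [← hss]
      nlinarith [mul_le_mul_of_nonneg_left h hs]
  have hv1 (t : ℝ) (ht : t ∈ Set.Icc (0 : ℝ) 1) : ‖v t - v 0‖ ≤ a * c * Real.exp s := by
    have h := (convex_Icc (0 : ℝ) 1).norm_image_sub_le_of_norm_hasDerivWithin_le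
      (fun t _ => (hv t).hasDerivWithinAt) (fun t ht => (hw t ht).trans (haj t ht))
      (Set.left_mem_Icc.2 zero_le_one) ht
    rw [sub_zero, Real.norm_of_nonneg ht.1] at h
    exact h.trans (mul_le_of_le_one_right (by positivity) ht.2)
  have h := (convex_Icc (0 : ℝ) 1).norm_image_sub_le_of_norm_hasDerivWithin_le
    (f := fun t => j t - t • v 0) (f' := fun t => v t - v 0)
    (fun t _ => by
      simpa using ((hj t).fun_sub ((hasDerivAt_id t).smul_const (v 0))).hasDerivWithinAt) hv1
    (Set.left_mem_Icc.2 zero_le_one) (Set.right_mem_Icc.2 zero_le_one)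
  simpa [sub_sub, add_comm] using h

/-- The entries of a square matrix, as a vector whose Euclidean norm is the Frobenius norm. -/
noncomputable def Matrix.toEuclideanVec {d : ℕ} (A : Matrix (Fin d) (Fin d) ℝ) :
    EuclideanSpace ℝ (Fin d × Fin d) :=
  WithLp.toLp 2 fun p => A p.1 p.2

theorem Matrix.norm_toEuclideanVec_sq {d : ℕ} (A : Matrix (Fin d) (Fin d) ℝ) :
    ‖A.toEuclideanVec‖ ^ 2 = ∑ i, ∑ j, A i j ^ 2 := by
  simp [EuclideanSpace.norm_sq_eq, toEuclideanVec, Fintype.sum_prod_type]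

theorem Matrix.norm_toEuclideanVec_one {d : ℕ} :
    ‖(1 : Matrix (Fin d) (Fin d) ℝ).toEuclideanVec‖ = √d := by
  rw [← Real.sqrt_sq (norm_nonneg _), norm_toEuclideanVec_sq]
  simp [Matrix.one_apply]

theorem Matrix.norm_toEuclideanVec_mul_le {d : ℕ} (A B : Matrix (Fin d) (Fin d) ℝ) :
    ‖(A * B).toEuclideanVec‖ ≤ ‖A.toEuclideanVec‖ * ‖B.toEuclideanVec‖ := by
  refine le_of_sq_le_sq ?_ (by positivity)
  rw [mul_pow, norm_toEuclideanVec_sq, norm_toEuclideanVec_sq, norm_toEuclideanVec_sq,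
    Finset.sum_comm (f := fun i j => B i j ^ 2), Finset.sum_mul_sum]
  refine Finset.sum_le_sum fun i _ => Finset.sum_le_sum fun j _ => ?_
  rw [Matrix.mul_apply]
  exact Finset.sum_mul_sq_le_sq_mul_sq _ _ _

theorem Matrix.norm_toEuclideanVec_le {d : ℕ} {A : Matrix (Fin d) (Fin d) ℝ} {κ : ℝ}
    (hκ : 0 ≤ κ) (hA : ∀ i j, |A i j| ≤ κ) : ‖A.toEuclideanVec‖ ≤ d * κ := by
  refine le_of_sq_le_sq ?_ (by positivity)
  rw [norm_toEuclideanVec_sq]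
  calc ∑ i, ∑ j, A i j ^ 2 ≤ ∑ _i : Fin d, ∑ _j : Fin d, κ ^ 2 :=
        Finset.sum_le_sum fun i _ => Finset.sum_le_sum fun j _ =>
          sq_le_sq.2 ((hA i j).trans (le_abs_self κ))
    _ = (d * κ) ^ 2 := by simp; ring

theorem Matrix.hasDerivAt_toEuclideanVec {d : ℕ} {A A' : ℝ → Matrix (Fin d) (Fin d) ℝ} {t : ℝ}
    (h : ∀ i j, HasDerivAt (fun s => A s i j) (A' t i j) t) :
    HasDerivAt (fun s => (A s).toEuclideanVec) (A' t).toEuclideanVec t :=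
  (PiLp.continuousLinearEquiv 2 ℝ fun _ : Fin d × Fin d => ℝ).symm.hasFDerivAt.comp_hasDerivAt t
    (hasDerivAt_pi.2 fun p => h p.1 p.2)

/-- Quantitative closeness to the identity of Jacobi matrices: if `J'' = −R·J` on
`[0,1]` with `|R(t)_{ij}| ≤ κ` there, and `(J(0), J'(0))` equals `(0, I_d)` or
`(I_d, 0)`, then `‖J(1) − I_d‖_F² ≤ d³ κ² e^{1 + dκ}`. -/
theorem jacobi_matrix_close_to_identity (d : ℕ) (hd : 1 ≤ d) (κ : ℝ) (hκ : 0 ≤ κ)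
    (R J J' J'' : ℝ → Matrix (Fin d) (Fin d) ℝ)
    (hRcont : ∀ i j, Continuous fun t => R t i j)
    (hRbound : ∀ t : ℝ, t ∈ Set.Icc (0 : ℝ) 1 → ∀ i j, |R t i j| ≤ κ)
    (hJder : ∀ (t : ℝ) (i j), HasDerivAt (fun s => J s i j) (J' t i j) t)
    (hJ'der : ∀ (t : ℝ) (i j), HasDerivAt (fun s => J' s i j) (J'' t i j) t)
    (hJ''cont : ∀ i j, Continuous fun t => J'' t i j)
    (hJacobi : ∀ t : ℝ, t ∈ Set.Icc (0 : ℝ) 1 → J'' t = -(R t * J t))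
    (hinit : (J 0 = 0 ∧ J' 0 = 1) ∨ (J 0 = 1 ∧ J' 0 = 0)) :
    ∑ i, ∑ j, (J 1 i j - (1 : Matrix (Fin d) (Fin d) ℝ) i j) ^ 2
      ≤ (d : ℝ) ^ 3 * κ ^ 2 * Real.exp (1 + (d : ℝ) * κ) := by
  have key := norm_sub_add_le_of_norm_second_deriv_le (c := √d) (a := d * κ)
    (j := fun t => (J t).toEuclideanVec) (by positivity)
    (fun t => hasDerivAt_toEuclideanVec (hJder t))
    (fun t => hasDerivAt_toEuclideanVec (hJ'der t))
    (fun t ht => by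
      have hneg : (-(R t * J t)).toEuclideanVec = -(R t * J t).toEuclideanVec := rfl
      rw [hJacobi t ht, hneg, norm_neg]
      refine (norm_toEuclideanVec_mul_le _ _).trans ?_
      gcongr
      exact norm_toEuclideanVec_le hκ (hRbound t ht))
    (by
      have hzero : (0 : Matrix (Fin d) (Fin d) ℝ).toEuclideanVec = 0 := rfl
      rcases hinit with ⟨h, h'⟩ | ⟨h, h'⟩
      · exact .inl ⟨by rw [h, hzero], by rw [h', norm_toEuclideanVec_one]⟩
      · exact .inr ⟨by rw [h, norm_toEuclideanVec_one], by rw [h', hzero]⟩)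
  have hsum : (J 0).toEuclideanVec + (J' 0).toEuclideanVec
      = (1 : Matrix (Fin d) (Fin d) ℝ).toEuclideanVec := by
    change (J 0 + J' 0).toEuclideanVec = _
    rcases hinit with ⟨h, h'⟩ | ⟨h, h'⟩ <;> simp [h, h']
  have hsub : (J 1).toEuclideanVec - (1 : Matrix (Fin d) (Fin d) ℝ).toEuclideanVec
      = (J 1 - 1).toEuclideanVec := rfl
  rw [hsum, hsub] at key
  have hsq := norm_toEuclideanVec_sq (J 1 - 1)
  simp only [Matrix.sub_apply] at hsq
  have ha : 0 ≤ d * κ := by positivity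
  rw [← hsq]
  calc ‖(J 1 - 1).toEuclideanVec‖ ^ 2
      ≤ (d * κ * √d * Real.exp (√(d * κ))) ^ 2 := by gcongr
    _ = d ^ 3 * κ ^ 2 * Real.exp (2 * √(d * κ)) := by
        rw [mul_pow, mul_pow, Real.sq_sqrt d.cast_nonneg, ← Real.exp_nat_mul]
        push_cast
        ring
    _ ≤ d ^ 3 * κ ^ 2 * Real.exp (1 + d * κ) := by
        gcongr
        nlinarith [sq_nonneg (√(d * κ) - 1), Real.sq_sqrt ha]
end

section
/- Let X be a set carrying two pseudometrics d and ρ, let E : X → [0, ∞), let 0 < h ≤ 1, let K ≥ 1 be an integer and set T := K·h. Let χ₀, χ₁, χ₂, … ∈ X and define the piecewise constant path χ(t) := χ_{⌊t/h⌋} for t ≥ 0. Assume that for all a, b ∈ X: ρ(a, b) ≤ d(a, b)²/(2√h) + 2√h·(E(a) + E(b)). Define C₀ := ∫_h^T d(χ(t), χ(t − h))²/(2h²) dt + 4·∫₀^T E(χ(t)) dt, and for s ∈ (0, T) define I(s) := ∫_s^T ρ(χ(t), χ(t − s)) dt. Then I(s) ≤ 4·C₀·√s for every s ∈ (0, min(T,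 1)]. (Square-root-in-time modulus of continuity for minimizing-movement-type paths.) -/
open MeasureTheory ENNReal

namespace MinimizingMovement

theorem sum_range_shift_le {f : ℕ → ℝ} (hf : ∀ i, 0 ≤ f i) {a n N : ℕ}
    (hN : ∀ i < n, i + a < N) :
    ∑ i ∈ Finset.range n, f (i + a) ≤ ∑ i ∈ Finset.range N, f i := by
  have hmap := Finset.sum_map (Finset.range n) (addRightEmbedding a) f
  simp only [addRightEmbedding_apply] at hmap
  rw [← hmap]
  refine Finset.sum_le_sum_of_subset_of_nonneg ?_ fun i _ _ => hf i
  intro x hx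
  obtain ⟨i, hi, rfl⟩ := Finset.mem_map.1 hx
  exact Finset.mem_range.2 (hN i (Finset.mem_range.1 hi))

section Discrete

variable {X : Type*}

/-- The total `ρ`-displacement over `p` steps of the path `χ 0, …, χ (K - 1)`. -/
def shiftSum (ρ : X → X → ℝ) (χ : ℕ → X) (K p : ℕ) : ℝ :=
  ∑ j ∈ Finset.range (K - p), ρ (χ (j + p)) (χ j)

theorem shiftSum_zero {ρ : X → X → ℝ} (hρ_refl : ∀ a, ρ a a = 0) (χ : ℕ → X) (K : ℕ) :
    shiftSum ρ χ K 0 = 0 := by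
  simp [shiftSum, hρ_refl]

theorem shiftSum_nonneg {ρ : X → X → ℝ} (hρ_nonneg : ∀ a b, 0 ≤ ρ a b) (χ : ℕ → X) (K p : ℕ) :
    0 ≤ shiftSum ρ χ K p :=
  Finset.sum_nonneg fun _ _ => hρ_nonneg _ _

theorem shiftSum_add_le {ρ : X → X → ℝ} (hρ_nonneg : ∀ a b, 0 ≤ ρ a b)
    (hρ_tri : ∀ a b c, ρ a c ≤ ρ a b + ρ b c) (χ : ℕ → X) (K p q : ℕ) :
    shiftSum ρ χ K (p + q) ≤ shiftSum ρ χ K p + shiftSum ρ χ K q := by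
  have h1 : ∑ j ∈ Finset.range (K - (p + q)), ρ (χ (j + p)) (χ j) ≤ shiftSum ρ χ K p :=
    sum_range_shift_le (f := fun j => ρ (χ (j + p)) (χ j)) (fun _ => hρ_nonneg _ _) (a := 0)
      (by intro i hi; omega)
  have h2 : ∑ j ∈ Finset.range (K - (p + q)), ρ (χ (j + p + q)) (χ (j + p))
      ≤ shiftSum ρ χ K q :=
    sum_range_shift_le (f := fun j => ρ (χ (j + q)) (χ j)) (fun _ => hρ_nonneg _ _) (a := p)
      (by intro i hi; omega)
  refine le_trans ?_ (add_le_add h1 h2)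
  rw [← Finset.sum_add_distrib]
  refine Finset.sum_le_sum fun j _ => ?_
  rw [add_comm (ρ _ _), ← add_assoc]
  exact hρ_tri _ _ _

theorem shiftSum_mul_le {ρ : X → X → ℝ} (hρ_nonneg : ∀ a b, 0 ≤ ρ a b)
    (hρ_refl : ∀ a, ρ a a = 0)
    (hρ_tri : ∀ a b c, ρ a c ≤ ρ a b + ρ b c) (χ : ℕ → X) (K n q : ℕ) :
    shiftSum ρ χ K (n * q) ≤ n * shiftSum ρ χ K q := by
  induction n with
  | zero => simp [shiftSum_zero hρ_refl]
  | succ n ih =>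
    have := shiftSum_add_le hρ_nonneg hρ_tri χ K (n * q) q
    rw [add_one_mul]
    push_cast
    linarith

theorem dist_shift_le_sum {d : X → X → ℝ} (hd_refl : ∀ a, d a a = 0)
    (hd_tri : ∀ a b c, d a c ≤ d a b + d b c) (χ : ℕ → X) (j p : ℕ) :
    d (χ (j + p)) (χ j) ≤ ∑ i ∈ Finset.range p, d (χ (j + i + 1)) (χ (j + i)) := by
  induction p with
  | zero => simp [hd_refl]
  | succ p ih =>
    rw [Finset.sum_range_succ]
    have := hd_tri (χ (j + (p + 1))) (χ (j + p)) (χ j)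
    rw [← add_assoc] at this ⊢
    linarith

theorem sum_dist_shift_sq_le {d : X → X → ℝ} (hd_nonneg : ∀ a b, 0 ≤ d a b)
    (hd_refl : ∀ a, d a a = 0)
    (hd_tri : ∀ a b c, d a c ≤ d a b + d b c) (χ : ℕ → X) (K p : ℕ) :
    ∑ j ∈ Finset.range (K - p), d (χ (j + p)) (χ j) ^ 2
      ≤ (p : ℝ) ^ 2 * ∑ l ∈ Finset.range (K - 1), d (χ (l + 1)) (χ l) ^ 2 := by
  calc ∑ j ∈ Finset.range (K - p), d (χ (j + p)) (χ j) ^ 2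
      ≤ ∑ j ∈ Finset.range (K - p),
          (p : ℝ) * ∑ i ∈ Finset.range p, d (χ (j + i + 1)) (χ (j + i)) ^ 2 := by
        refine Finset.sum_le_sum fun j _ => ?_
        have h1 := pow_le_pow_left₀ (hd_nonneg _ _) (dist_shift_le_sum hd_refl hd_tri χ j p) 2
        have h2 := sq_sum_le_card_mul_sum_sq (s := Finset.range p)
          (f := fun i => d (χ (j + i + 1)) (χ (j + i)))
        rw [Finset.card_range] at h2
        exact h1.trans h2
    _ = (p : ℝ) * ∑ i ∈ Finset.range p, ∑ j ∈ Finset.range (K - p),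
          d (χ (j + i + 1)) (χ (j + i)) ^ 2 := by
        rw [← Finset.mul_sum, Finset.sum_comm]
    _ ≤ (p : ℝ) * ∑ _i ∈ Finset.range p,
          ∑ l ∈ Finset.range (K - 1), d (χ (l + 1)) (χ l) ^ 2 := by
        gcongr with i hi
        rw [Finset.mem_range] at hi
        exact sum_range_shift_le (f := fun l => d (χ (l + 1)) (χ l) ^ 2)
          (fun _ => sq_nonneg _) (by intro j hj; omega)
    _ = _ := by
        rw [Finset.sum_const, Finset.card_range, nsmul_eq_mul]
        ring

/-- The discrete form of `C₀`. -/
noncomputable def energy (d : X → X → ℝ) (E : X → ℝ) (h : ℝ) (χ : ℕ → X) (K : ℕ) : ℝ :=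
  (∑ l ∈ Finset.range (K - 1), d (χ (l + 1)) (χ l) ^ 2) / (2 * h)
    + 4 * (h * ∑ k ∈ Finset.range K, E (χ k))

theorem energy_nonneg (d : X → X → ℝ) {E : X → ℝ} (hE : ∀ a, 0 ≤ E a) {h : ℝ} (hh0 : 0 < h)
    (χ : ℕ → X) (K : ℕ) : 0 ≤ energy d E h χ K := by
  have h1 : 0 ≤ ∑ l ∈ Finset.range (K - 1), d (χ (l + 1)) (χ l) ^ 2 :=
    Finset.sum_nonneg fun _ _ => sq_nonneg _
  have h2 : 0 ≤ ∑ k ∈ Finset.range K, E (χ k) := Finset.sum_nonneg fun _ _ => hE _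
  unfold energy
  positivity

variable {d ρ : X → X → ℝ} {E : X → ℝ} {h : ℝ}

theorem mul_shiftSum_le_of_sq_le (hd_nonneg : ∀ a b, 0 ≤ d a b) (hd_refl : ∀ a, d a a = 0)
    (hd_tri : ∀ a b c, d a c ≤ d a b + d b c) (hE : ∀ a, 0 ≤ E a) (hh0 : 0 < h)
    (hcomp : ∀ a b, ρ a b ≤ d a b ^ 2 / (2 * √h) + 2 * √h * (E a + E b))
    (χ : ℕ → X) (K p : ℕ) (hp : h * (p : ℝ) ^ 2 ≤ 1) :
    h * shiftSum ρ χ K p ≤ √h * energy d E h χ K := by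
  have hw : 0 < √h := Real.sqrt_pos.2 hh0
  have hwh : √h ^ 2 = h := Real.sq_sqrt hh0.le
  set D := ∑ l ∈ Finset.range (K - 1), d (χ (l + 1)) (χ l) ^ 2 with hD
  set e := ∑ k ∈ Finset.range K, E (χ k) with he
  have hD0 : 0 ≤ D := Finset.sum_nonneg fun _ _ => sq_nonneg _
  have h1 := sum_dist_shift_sq_le hd_nonneg hd_refl hd_tri χ K p
  have h2 : ∑ j ∈ Finset.range (K - p), E (χ (j + p)) ≤ e :=
    sum_range_shift_le (f := fun j => E (χ j)) (fun _ => hE _) (by intro i hi; omega)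
  have h3 : ∑ j ∈ Finset.range (K - p), E (χ j) ≤ e :=
    sum_range_shift_le (f := fun j => E (χ j)) (fun _ => hE _) (a := 0) (by intro i hi; omega)
  have h4 : shiftSum ρ χ K p ≤ (p : ℝ) ^ 2 * D / (2 * √h) + 2 * √h * (e + e) := by
    calc shiftSum ρ χ K p
        ≤ ∑ j ∈ Finset.range (K - p), (d (χ (j + p)) (χ j) ^ 2 / (2 * √h)
            + 2 * √h * (E (χ (j + p)) + E (χ j))) :=
          Finset.sum_le_sum fun _ _ => hcomp _ _
      _ = (∑ j ∈ Finset.range (K - p), d (χ (j + p)) (χ j) ^ 2) / (2 * √h)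
            + 2 * √h * (∑ j ∈ Finset.range (K - p), E (χ (j + p))
              + ∑ j ∈ Finset.range (K - p), E (χ j)) := by
          rw [Finset.sum_add_distrib, ← Finset.sum_div, ← Finset.mul_sum,
            Finset.sum_add_distrib]
      _ ≤ _ := by gcongr
  calc h * shiftSum ρ χ K p
      ≤ h * ((p : ℝ) ^ 2 * D / (2 * √h) + 2 * √h * (e + e)) := by gcongr
    _ = √h * ((h * (p : ℝ) ^ 2) * D / (2 * h) + 4 * (h * e)) := by
        generalize √h = w at *
        subst hwh
        field_simp
        ring
    _ ≤ √h * (1 * D / (2 * h) + 4 * (h * e)) := by gcongr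
    _ = √h * energy d E h χ K := by rw [one_mul]; rfl

theorem mul_shiftSum_le (hd_nonneg : ∀ a b, 0 ≤ d a b) (hd_refl : ∀ a, d a a = 0)
    (hd_tri : ∀ a b c, d a c ≤ d a b + d b c)
    (hρ_nonneg : ∀ a b, 0 ≤ ρ a b) (hρ_refl : ∀ a, ρ a a = 0)
    (hρ_tri : ∀ a b c, ρ a c ≤ ρ a b + ρ b c)
    (hE : ∀ a, 0 ≤ E a) (hh0 : 0 < h) (hh1 : h ≤ 1)
    (hcomp : ∀ a b, ρ a b ≤ d a b ^ 2 / (2 * √h) + 2 * √h * (E a + E b))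
    (χ : ℕ → X) (K p : ℕ) :
    h * shiftSum ρ χ K p ≤ (2 * (p * h) + √h) * energy d E h χ K := by
  have hw : 0 < √h := Real.sqrt_pos.2 hh0
  have hwh : √h ^ 2 = h := Real.sq_sqrt hh0.le
  have hw1 : √h ≤ 1 := Real.sqrt_le_one.2 hh1
  have hC := energy_nonneg d hE hh0 χ K
  obtain ⟨q, hq⟩ : ∃ q, q = ⌊(√h)⁻¹⌋₊ := ⟨_, rfl⟩
  have hq1 : 1 ≤ q := by
    rw [hq, Nat.one_le_floor_iff]
    exact (one_le_inv₀ hw).2 hw1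
  have hqle : (q : ℝ) * √h ≤ 1 := by
    have : (q : ℝ) ≤ (√h)⁻¹ := hq ▸ Nat.floor_le (by positivity)
    calc (q : ℝ) * √h ≤ (√h)⁻¹ * √h := by gcongr
      _ = 1 := inv_mul_cancel₀ hw.ne'
  have hqge : 1 ≤ 2 * q * √h := by
    have h1 : (√h)⁻¹ < q + 1 := hq ▸ Nat.lt_floor_add_one _
    have h2 : (1 : ℝ) ≤ q := by exact_mod_cast hq1
    calc 1 = (√h)⁻¹ * √h := (inv_mul_cancel₀ hw.ne').symm
      _ ≤ 2 * q * √h := by gcongr; linarith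
  have hsq : ∀ b : ℕ, b ≤ q → h * (b : ℝ) ^ 2 ≤ 1 := by
    intro b hb
    have h1 : (b : ℝ) * √h ≤ 1 := le_trans (by gcongr) hqle
    calc h * (b : ℝ) ^ 2 = (b * √h) ^ 2 := by rw [mul_pow, hwh, mul_comm]
      _ ≤ 1 := pow_le_one₀ (by positivity) h1
  have key : ∀ b : ℕ, b ≤ q → h * shiftSum ρ χ K b ≤ √h * energy d E h χ K := fun b hb =>
    mul_shiftSum_le_of_sq_le hd_nonneg hd_refl hd_tri hE hh0 hcomp χ K b (hsq b hb)
  have hdiv : (p / q : ℕ) * q + p % q = p := Nat.div_add_mod' p q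
  have hn : ((p / q : ℕ) : ℝ) * √h ≤ 2 * (p * h) := by
    have h1 : ((p / q : ℕ) : ℝ) * q ≤ p := by exact_mod_cast Nat.div_mul_le_self p q
    calc ((p / q : ℕ) : ℝ) * √h = ((p / q : ℕ) : ℝ) * √h * 1 := (mul_one _).symm
      _ ≤ ((p / q : ℕ) : ℝ) * √h * (2 * q * √h) := by gcongr
      _ = 2 * (((p / q : ℕ) : ℝ) * q) * √h ^ 2 := by ring
      _ ≤ 2 * p * √h ^ 2 := by gcongr
      _ = 2 * (p * h) := by rw [hwh, mul_assoc]
  calc h * shiftSum ρ χ K p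
      = h * shiftSum ρ χ K (p / q * q + p % q) := by rw [hdiv]
    _ ≤ h * ((p / q : ℕ) * shiftSum ρ χ K q + shiftSum ρ χ K (p % q)) := by
        gcongr
        exact (shiftSum_add_le hρ_nonneg hρ_tri χ K _ _).trans
          (by gcongr; exact shiftSum_mul_le hρ_nonneg hρ_refl hρ_tri χ K _ _)
    _ = (p / q : ℕ) * (h * shiftSum ρ χ K q) + h * shiftSum ρ χ K (p % q) := by ring
    _ ≤ (p / q : ℕ) * (√h * energy d E h χ K) + √h * energy d E h χ K := by
        exact add_le_add (mul_le_mul_of_nonneg_left (key q le_rfl) (Nat.cast_nonneg _))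
          (key _ (Nat.mod_lt _ hq1).le)
    _ = ((p / q : ℕ) * √h + √h) * energy d E h χ K := by ring
    _ ≤ _ := by gcongr

theorem interpolated_shiftSum_le (hd_nonneg : ∀ a b, 0 ≤ d a b) (hd_refl : ∀ a, d a a = 0)
    (hd_tri : ∀ a b c, d a c ≤ d a b + d b c)
    (hρ_nonneg : ∀ a b, 0 ≤ ρ a b) (hρ_refl : ∀ a, ρ a a = 0)
    (hρ_tri : ∀ a b c, ρ a c ≤ ρ a b + ρ b c)
    (hE : ∀ a, 0 ≤ E a) (hh0 : 0 < h) (hh1 : h ≤ 1)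
    (hcomp : ∀ a b, ρ a b ≤ d a b ^ 2 / (2 * √h) + 2 * √h * (E a + E b))
    (χ : ℕ → X) (K m : ℕ) {r : ℝ} (hr0 : 0 ≤ r) (hrh : r ≤ h) (hs1 : m * h + r ≤ 1) :
    (h - r) * shiftSum ρ χ K m + r * shiftSum ρ χ K (m + 1)
      ≤ 4 * energy d E h χ K * √(m * h + r) := by
  have hw : 0 < √h := Real.sqrt_pos.2 hh0
  have hwh : √h ^ 2 = h := Real.sq_sqrt hh0.le
  have hC := energy_nonneg d hE hh0 χ K
  rcases Nat.eq_zero_or_pos m with rfl | hm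
  · have h1 := mul_shiftSum_le_of_sq_le hd_nonneg hd_refl hd_tri hE hh0 hcomp χ K 1 (by simpa)
    have hr : √r ≤ √h := Real.sqrt_le_sqrt hrh
    have hrr : √r ^ 2 = r := Real.sq_sqrt hr0
    have h2 : √h * shiftSum ρ χ K 1 ≤ energy d E h χ K := by
      refine le_of_mul_le_mul_left ?_ hw
      rw [← mul_assoc, ← sq, hwh]
      exact h1
    have hS := shiftSum_nonneg hρ_nonneg χ K 1
    rw [shiftSum_zero hρ_refl]
    simp only [Nat.cast_zero, zero_mul, zero_add, mul_zero]
    calc r * shiftSum ρ χ K 1 = √r * (√r * shiftSum ρ χ K 1) := by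
          rw [← mul_assoc, ← sq, hrr]
      _ ≤ √r * (√h * shiftSum ρ χ K 1) := by gcongr
      _ ≤ √r * energy d E h χ K := by gcongr
      _ ≤ 4 * energy d E h χ K * √r := by nlinarith [mul_nonneg (Real.sqrt_nonneg r) hC]
  · have hm1 : (1 : ℝ) ≤ m := by exact_mod_cast hm
    have hb := mul_shiftSum_le hd_nonneg hd_refl hd_tri hρ_nonneg hρ_refl hρ_tri hE hh0 hh1
      hcomp χ K
    set s := m * h + r with hs
    have hhs : h ≤ s := by nlinarith
    have hs0 : 0 ≤ s := hh0.le.trans hhs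
    have h1 : √h ≤ √s := Real.sqrt_le_sqrt hhs
    have h2 : s ≤ √s := Real.le_sqrt_of_sq_le (by nlinarith)
    have h3 : (h - r) * shiftSum ρ χ K m + r * shiftSum ρ χ K (m + 1)
        ≤ (2 * s + √h) * energy d E h χ K := by
      refine le_of_mul_le_mul_left ?_ hh0
      have e1 := mul_le_mul_of_nonneg_left (hb m) (sub_nonneg.2 hrh)
      have e2 := mul_le_mul_of_nonneg_left (hb (m + 1)) hr0
      push_cast at e2
      calc _ = (h - r) * (h * shiftSum ρ χ K m) + r * (h * shiftSum ρ χ K (m + 1)) := by ring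
        _ ≤ _ := add_le_add e1 e2
        _ = _ := by rw [hs]; ring
    calc _ ≤ (2 * s + √h) * energy d E h χ K := h3
      _ ≤ (4 * √s) * energy d E h χ K := by
          gcongr
          linarith [Real.sqrt_nonneg s]
      _ = _ := by ring

end Discrete

section Integrals

theorem setLIntegral_Ico_of_eqOn_const {f : ℝ → ℝ≥0∞} {c : ℝ≥0∞} {a b : ℝ}
    (hf : ∀ t ∈ Set.Ico a b, f t = c) :
    ∫⁻ t in Set.Ico a b, f t = ENNReal.ofReal (b - a) * c := by
  rw [setLIntegral_congr_fun measurableSet_Ico hf, setLIntegral_const, Real.volume_Ico, mul_comm]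

theorem setLIntegral_Ico_add {f : ℝ → ℝ≥0∞} {a b c : ℝ} (hab : a ≤ b) (hbc : b ≤ c) :
    ∫⁻ t in Set.Ico a c, f t = (∫⁻ t in Set.Ico a b, f t) + ∫⁻ t in Set.Ico b c, f t := by
  rw [← Set.Ico_union_Ico_eq_Ico hab hbc,
    lintegral_union measurableSet_Ico (Set.Ico_disjoint_Ico_same)]

variable {h : ℝ}

theorem floor_div_eq (hh0 : 0 < h) {k : ℕ} {t : ℝ} (h1 : k * h ≤ t) (h2 : t < (k + 1) * h) :
    ⌊t / h⌋₊ = k := by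
  have h0 : 0 ≤ t / h := div_nonneg (le_trans (by positivity) h1) hh0.le
  rw [Nat.floor_eq_iff h0]
  exact ⟨(le_div_iff₀ hh0).2 h1, (div_lt_iff₀ hh0).2 h2⟩

theorem setLIntegral_Ico_floor (hh0 : 0 < h) (f : ℕ → ℝ≥0∞) (p n : ℕ) :
    ∫⁻ t in Set.Ico (p * h) ((p + n : ℕ) * h), f ⌊t / h⌋₊
      = ENNReal.ofReal h * ∑ j ∈ Finset.range n, f (j + p) := by
  induction n with
  | zero => simp
  | succ n ih =>
    have e : ((p + (n + 1) : ℕ) : ℝ) * h = ((p + n : ℕ) + 1) * h := by push_cast; ring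
    rw [e, setLIntegral_Ico_add (b := (p + n : ℕ) * h) (by gcongr; simp) (by nlinarith), ih,
      setLIntegral_Ico_of_eqOn_const (c := f (n + p)), Finset.sum_range_succ, mul_add]
    · congr 3
      ring
    · intro t ht
      rw [floor_div_eq hh0 ht.1 ht.2, add_comm]

theorem setLIntegral_Ico_floor_shift (hh0 : 0 < h) (F : ℕ → ℕ → ℝ≥0∞) (m n : ℕ) {r : ℝ}
    (hr0 : 0 ≤ r) (hrh : r ≤ h) :
    ∫⁻ t in Set.Ico (m * h + r) ((m + 1 + n : ℕ) * h), F ⌊t / h⌋₊ ⌊(t - (m * h + r)) / h⌋₊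
      = ENNReal.ofReal (h - r) * ∑ j ∈ Finset.range (n + 1), F (j + m) j
        + ENNReal.ofReal r * ∑ j ∈ Finset.range n, F (j + (m + 1)) j := by
  induction n with
  | zero =>
    rw [setLIntegral_Ico_of_eqOn_const (c := F m 0)]
    · simp only [zero_add, Finset.sum_range_one, Finset.sum_range_zero, mul_zero, add_zero]
      congr 2
      push_cast
      ring
    · intro t ht
      have h2 := ht.2
      push_cast at h2
      rw [floor_div_eq (k := m) hh0 (by linarith [ht.1]) (by linarith),
        floor_div_eq (k := 0) hh0 (by simpa using ht.1) (by push_cast; linarith)]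
  | succ n ih =>
    rw [setLIntegral_Ico_add (b := (m + 1 + n : ℕ) * h) (by push_cast; nlinarith)
        (by gcongr; omega), ih,
      setLIntegral_Ico_add (a := (m + 1 + n : ℕ) * h) (b := (m + 1 + n : ℕ) * h + r)
        (by linarith) (by push_cast; linarith),
      setLIntegral_Ico_of_eqOn_const (c := F (n + (m + 1)) n),
      setLIntegral_Ico_of_eqOn_const (c := F (n + 1 + m) (n + 1)),
      Finset.sum_range_succ _ (n + 1), Finset.sum_range_succ (fun j => F (j + (m + 1)) j) n]
    · have e1 : ((m + 1 + n : ℕ) : ℝ) * h + r - (m + 1 + n : ℕ) * h = r := by ring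
      have e2 : ((m + 1 + (n + 1) : ℕ) : ℝ) * h - ((m + 1 + n : ℕ) * h + r) = h - r := by
        push_cast; ring
      rw [e1, e2]
      ring
    · intro t ht
      obtain ⟨h1, h2⟩ := ht
      push_cast at h1 h2
      rw [floor_div_eq (k := n + 1 + m) hh0 (by push_cast; linarith) (by push_cast; linarith),
        floor_div_eq (k := n + 1) hh0 (by push_cast; linarith) (by push_cast; linarith)]
    · intro t ht
      obtain ⟨h1, h2⟩ := ht
      push_cast at h1 h2
      rw [floor_div_eq (k := n + (m + 1)) hh0 (by push_cast; linarith) (by push_cast; linarith),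
        floor_div_eq (k := n) hh0 (by linarith) (by linarith)]

end Integrals

section Path

variable {X : Type*} {h : ℝ}

theorem lintegral_path_eq_energy (d : X → X → ℝ) {E : X → ℝ} (hE : ∀ a, 0 ≤ E a)
    (hh0 : 0 < h) (χ : ℕ → X) {K : ℕ} (hK : 1 ≤ K) :
    (∫⁻ t in Set.Ioc h (K * h),
        ENNReal.ofReal (d (χ ⌊t / h⌋₊) (χ ⌊(t - h) / h⌋₊) ^ 2 / (2 * h ^ 2)))
      + 4 * ∫⁻ t in Set.Ioc (0 : ℝ) (K * h), ENNReal.ofReal (E (χ ⌊t / h⌋₊))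
      = ENNReal.ofReal (energy d E h χ K) := by
  have hsub : ∀ t : ℝ, ⌊(t - h) / h⌋₊ = ⌊t / h⌋₊ - 1 := fun t => by
    rw [sub_div, div_self hh0.ne', Nat.floor_sub_one]
  have h1 := setLIntegral_Ico_floor hh0
    (fun k => ENNReal.ofReal (d (χ k) (χ (k - 1)) ^ 2 / (2 * h ^ 2))) 1 (K - 1)
  have h2 := setLIntegral_Ico_floor hh0 (fun k => ENNReal.ofReal (E (χ k))) 0 K
  rw [Nat.add_sub_cancel' hK, Nat.cast_one, one_mul] at h1
  rw [zero_add, Nat.cast_zero, zero_mul] at h2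
  simp only [hsub]
  rw [setLIntegral_congr Ico_ae_eq_Ioc.symm, h1, setLIntegral_congr Ico_ae_eq_Ioc.symm, h2]
  simp only [add_tsub_cancel_right, add_zero]
  rw [← ENNReal.ofReal_sum_of_nonneg (fun _ _ => by positivity),
    ← ENNReal.ofReal_sum_of_nonneg (fun _ _ => hE _), ← ENNReal.ofReal_mul hh0.le,
    ← ENNReal.ofReal_mul hh0.le, ← ENNReal.ofReal_ofNat 4, ← ENNReal.ofReal_mul (by norm_num),
    ← ENNReal.ofReal_add]
  · congr 1
    rw [energy, ← Finset.sum_div]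
    field_simp
  · exact mul_nonneg hh0.le (Finset.sum_nonneg fun _ _ => by positivity)
  · exact mul_nonneg (by norm_num) (mul_nonneg hh0.le (Finset.sum_nonneg fun _ _ => hE _))

theorem lintegral_path_shift_eq {ρ : X → X → ℝ} (hρ_nonneg : ∀ a b, 0 ≤ ρ a b)
    (hh0 : 0 < h) (χ : ℕ → X) {K m : ℕ} (hm : m < K) {r : ℝ} (hr0 : 0 ≤ r) (hrh : r ≤ h) :
    ∫⁻ t in Set.Ioc (m * h + r) (K * h),
        ENNReal.ofReal (ρ (χ ⌊t / h⌋₊) (χ ⌊(t - (m * h + r)) / h⌋₊))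
      = ENNReal.ofReal ((h - r) * shiftSum ρ χ K m + r * shiftSum ρ χ K (m + 1)) := by
  obtain ⟨n, rfl⟩ := Nat.exists_eq_add_of_le (Nat.succ_le_of_lt hm)
  have h1 := setLIntegral_Ico_floor_shift hh0
    (fun i j => ENNReal.ofReal (ρ (χ i) (χ j))) m n hr0 hrh
  have em : m.succ + n - m = n + 1 := by omega
  have em' : m.succ + n - (m + 1) = n := by omega
  rw [setLIntegral_congr Ico_ae_eq_Ioc.symm, h1,
    ← ENNReal.ofReal_sum_of_nonneg (fun _ _ => hρ_nonneg _ _),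
    ← ENNReal.ofReal_sum_of_nonneg (fun _ _ => hρ_nonneg _ _),
    ← ENNReal.ofReal_mul (sub_nonneg.2 hrh), ← ENNReal.ofReal_mul hr0, ← ENNReal.ofReal_add,
    shiftSum, shiftSum, em, em']
  · exact mul_nonneg (sub_nonneg.2 hrh) (Finset.sum_nonneg fun _ _ => hρ_nonneg _ _)
  · exact mul_nonneg hr0 (Finset.sum_nonneg fun _ _ => hρ_nonneg _ _)

end Path

end MinimizingMovement

open MinimizingMovement

/-- Square-root-in-time modulus of continuity for minimizing-movement-type paths:
with the piecewise constant path `t ↦ χ ⌊t/h⌋`, if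
`ρ(a,b) ≤ d(a,b)²/(2√h) + 2√h (E a + E b)` for all `a, b`, then for `0 < s ≤ min(T,1)`,
`I(s) := ∫_s^T ρ(χ(t), χ(t−s)) dt ≤ 4 C₀ √s`, where
`C₀ = ∫_h^T d(χ(t), χ(t−h))²/(2h²) dt + 4 ∫_0^T E(χ(t)) dt` and `T = K·h`. -/
theorem modulus_of_continuity {X : Type*}
    (d ρ : X → X → ℝ) (E : X → ℝ)
    (hd_nonneg : ∀ a b, 0 ≤ d a b) (hd_symm : ∀ a b, d a b = d b a)
    (hd_refl : ∀ a, d a a = 0) (hd_tri : ∀ a b c, d a c ≤ d a b + d b c)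
    (hρ_nonneg : ∀ a b, 0 ≤ ρ a b) (hρ_symm : ∀ a b, ρ a b = ρ b a)
    (hρ_refl : ∀ a, ρ a a = 0) (hρ_tri : ∀ a b c, ρ a c ≤ ρ a b + ρ b c)
    (hE : ∀ a, 0 ≤ E a)
    (h : ℝ) (hh0 : 0 < h) (hh1 : h ≤ 1) (K : ℕ) (hK : 1 ≤ K)
    (χ : ℕ → X)
    (hcomp : ∀ a b, ρ a b ≤ d a b ^ 2 / (2 * Real.sqrt h) + 2 * Real.sqrt h * (E a + E b)) :
    ∀ s : ℝ, 0 < s → s ≤ min ((K : ℝ) * h) 1 →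
      ∫⁻ t in Set.Ioc s ((K : ℝ) * h),
          ENNReal.ofReal (ρ (χ ⌊t / h⌋₊) (χ ⌊(t - s) / h⌋₊)) ∂volume
        ≤ 4 *
            ((∫⁻ t in Set.Ioc h ((K : ℝ) * h),
                ENNReal.ofReal (d (χ ⌊t / h⌋₊) (χ ⌊(t - h) / h⌋₊) ^ 2 / (2 * h ^ 2)) ∂volume)
              + 4 * ∫⁻ t in Set.Ioc (0 : ℝ) ((K : ℝ) * h),
                  ENNReal.ofReal (E (χ ⌊t / h⌋₊)) ∂volume)
          * ENNReal.ofReal (Real.sqrt s) := by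
  intro s hs0 hs
  rw [lintegral_path_eq_energy d hE hh0 χ hK]
  rcases (hs.trans (min_le_left _ _)).eq_or_lt with hsT | hsT
  · simp [hsT]
  have hm0 : (⌊s / h⌋₊ : ℝ) * h ≤ s :=
    (le_div_iff₀ hh0).1 (Nat.floor_le (div_nonneg hs0.le hh0.le))
  have hm1 : s < (⌊s / h⌋₊ + 1) * h := (div_lt_iff₀ hh0).1 (Nat.lt_floor_add_one _)
  generalize ⌊s / h⌋₊ = m at hm0 hm1
  obtain ⟨r, rfl⟩ : ∃ r, s = m * h + r := ⟨s - m * h, by ring⟩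
  have hr0 : 0 ≤ r := by linarith
  have hrh : r ≤ h := by linarith
  have hmK : m < K := by
    have : (m : ℝ) < K := lt_of_mul_lt_mul_right (hm0.trans_lt hsT) hh0.le
    exact_mod_cast this
  rw [lintegral_path_shift_eq hρ_nonneg hh0 χ hmK hr0 hrh, ← ENNReal.ofReal_ofNat 4,
    ← ENNReal.ofReal_mul (by norm_num),
    ← ENNReal.ofReal_mul (mul_nonneg (by norm_num) (energy_nonneg d hE hh0 χ K))]
  exact ENNReal.ofReal_le_ofReal (interpolated_shiftSum_le hd_nonneg hd_refl hd_tri hρ_nonneg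
    hρ_refl hρ_tri hE hh0 hh1 hcomp χ K m hr0 hrh (hs.trans (min_le_right _ _)))
end

section
/- Let s > 0, let L ≥ 1 be an integer, set T := L·s, and let F : ℝ × ℝ → [0, ∞) be measurable with F(t, τ) = F(τ, t) for all t, τ. Then Σ_{ℓ=1}^{L} (1/s)·∫_{(ℓ−1)s}^{ℓs} ∫_{(ℓ−1)s}^{ℓs} F(t, τ) dt dτ ≤ (2/s)·∫₀^{s} ∫_{s′}^{T} F(τ, τ − s′) dτ ds′. -/
open MeasureTheory ENNReal

/-- The integral of a symmetric function over a square is at most twice its integral over the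
part of the square below the diagonal. -/
theorem lintegral_square_le_two_mul_of_symm (A : Set ℝ) (F : ℝ → ℝ → ℝ≥0∞)
    (hF : Measurable (Function.uncurry F)) (hsymm : ∀ t τ, F t τ = F τ t) :
    ∫⁻ τ in A, ∫⁻ t in A, F t τ
      ≤ 2 * ∫⁻ τ in A, ∫⁻ t in A, (Set.Iio τ).indicator (fun t => F τ t) t := by
  have hlt : Measurable (Function.uncurry
      fun τ t : ℝ => (Set.Iio τ).indicator (fun t => F τ t) t) :=
    hF.indicator (measurableSet_lt measurable_snd measurable_fst)
  have hgt : Measurable (Function.uncurry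
      fun τ t : ℝ => (Set.Iio t).indicator (fun τ => F t τ) τ) :=
    hlt.comp measurable_swap
  have hsplit : ∀ τ, ∫⁻ t in A, F t τ
      ≤ (∫⁻ t in A, (Set.Iio τ).indicator (fun t => F τ t) t)
        + ∫⁻ t in A, (Set.Iio t).indicator (fun τ => F t τ) τ := by
    intro τ
    have hτ : Measurable fun t => (Set.Iio τ).indicator (fun t => F τ t) t :=
      hlt.comp measurable_prodMk_left
    rw [← lintegral_add_left hτ]
    have hne : ∀ᵐ t ∂volume.restrict A, t ≠ τ := Measure.ae_ne _ τ
    refine lintegral_mono_ae ?_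
    filter_upwards [hne] with t ht
    rcases lt_or_gt_of_ne ht with h | h
    · simp [Set.indicator, h, hsymm t τ]
    · simp [Set.indicator, h]
  calc _ ≤ ∫⁻ τ in A, ((∫⁻ t in A, (Set.Iio τ).indicator (fun t => F τ t) t)
        + ∫⁻ t in A, (Set.Iio t).indicator (fun τ => F t τ) τ) := lintegral_mono hsplit
    _ = _ := by
      rw [lintegral_add_left hlt.lintegral_prod_right, two_mul,
        lintegral_lintegral_swap hgt.aemeasurable]

/-- In the variable `s' = τ - t`, the part of the square `(a, a + s]²` below the diagonal is
contained in `0 < s' ≤ s`, `s' < τ` whenever `0 ≤ a`. -/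
theorem lintegral_below_diagonal_le {s a b τ : ℝ} (ha : 0 ≤ a) (hb : b ≤ a + s)
    (hτ : τ ∈ Set.Ioc a b) (f : ℝ → ℝ≥0∞) :
    ∫⁻ t in Set.Ioc a b, (Set.Iio τ).indicator f t
      ≤ ∫⁻ s' in Set.Ioc 0 s, (Set.Iio τ).indicator (fun s' => f (τ - s')) s' := by
  rw [← lintegral_indicator measurableSet_Ioc, ← lintegral_indicator measurableSet_Ioc,
    ← lintegral_sub_left_eq_self _ τ]
  refine lintegral_mono fun s' => ?_
  simp only [Set.indicator, Set.mem_Ioc, Set.mem_Iio] at hτ ⊢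
  obtain ⟨h1, h2⟩ := hτ
  split_ifs <;> first | exact le_rfl | exact bot_le | (exfalso; grind)

/-- Set integrals over the consecutive intervals of length `s` add up. -/
theorem sum_lintegral_Ioc_consecutive {s : ℝ} (hs : 0 ≤ s) (L : ℕ) (h : ℝ → ℝ≥0∞) :
    ∑ ℓ ∈ Finset.Icc 1 L, ∫⁻ τ in Set.Ioc (((ℓ : ℝ) - 1) * s) ((ℓ : ℝ) * s), h τ
      = ∫⁻ τ in Set.Ioc 0 ((L : ℝ) * s), h τ := by
  induction L with
  | zero => simp
  | succ n ih =>
    rw [Finset.sum_Icc_succ_top (by omega), ih]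
    have hn : ((n + 1 : ℕ) : ℝ) - 1 = n := by push_cast; ring
    rw [hn, ← lintegral_union measurableSet_Ioc
      (Set.Ioc_disjoint_Ioc_of_le le_rfl), Set.Ioc_union_Ioc_eq_Ioc (by positivity)]
    push_cast
    nlinarith

/-- Symmetrization estimate for time averages: for a nonnegative measurable symmetric
`F` on `ℝ × ℝ`, `s > 0`, `L ≥ 1` and `T = L·s`,
`Σ_{ℓ=1}^L (1/s) ∫_{(ℓ−1)s}^{ℓs} ∫_{(ℓ−1)s}^{ℓs} F(t,τ) dt dτ
  ≤ (2/s) ∫_0^s ∫_{s'}^T F(τ, τ−s') dτ ds'`. -/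
theorem block_average_symmetrization (s : ℝ) (hs : 0 < s) (L : ℕ) (hL : 1 ≤ L)
    (F : ℝ → ℝ → ℝ≥0∞) (hF : Measurable (Function.uncurry F))
    (hsymm : ∀ t τ, F t τ = F τ t) :
    ∑ ℓ ∈ Finset.Icc 1 L,
        ENNReal.ofReal (1 / s) *
          ∫⁻ τ in Set.Ioc (((ℓ : ℝ) - 1) * s) ((ℓ : ℝ) * s),
            (∫⁻ t in Set.Ioc (((ℓ : ℝ) - 1) * s) ((ℓ : ℝ) * s), F t τ ∂volume) ∂volume
      ≤ ENNReal.ofReal (2 / s) *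
          ∫⁻ s' in Set.Ioc (0 : ℝ) s,
            (∫⁻ τ in Set.Ioc s' ((L : ℝ) * s), F τ (τ - s') ∂volume) ∂volume := by
  have hG : Measurable (Function.uncurry
      fun τ s' : ℝ => (Set.Iio τ).indicator (fun s' => F τ (τ - s')) s') :=
    (hF.comp (measurable_fst.prodMk (measurable_fst.sub measurable_snd))).indicator
      (measurableSet_lt measurable_snd measurable_fst)
  have hblock : ∀ ℓ ∈ Finset.Icc 1 L,
      ∫⁻ τ in Set.Ioc (((ℓ : ℝ) - 1) * s) ((ℓ : ℝ) * s),
          ∫⁻ t in Set.Ioc (((ℓ : ℝ) - 1) * s) ((ℓ : ℝ) * s), F t τ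
        ≤ 2 * ∫⁻ τ in Set.Ioc (((ℓ : ℝ) - 1) * s) ((ℓ : ℝ) * s),
          ∫⁻ s' in Set.Ioc 0 s, (Set.Iio τ).indicator (fun s' => F τ (τ - s')) s' := by
    intro ℓ hℓ
    have hℓ1 : (1 : ℝ) ≤ ℓ := by exact_mod_cast (Finset.mem_Icc.1 hℓ).1
    refine (lintegral_square_le_two_mul_of_symm _ F hF hsymm).trans ?_
    gcongr 2 * ?_
    exact setLIntegral_mono' measurableSet_Ioc fun τ hτ =>
      lintegral_below_diagonal_le (mul_nonneg (by linarith) hs.le) (by linarith) hτ (F τ)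
  have hswap : ∫⁻ τ in Set.Ioc 0 ((L : ℝ) * s),
        ∫⁻ s' in Set.Ioc 0 s, (Set.Iio τ).indicator (fun s' => F τ (τ - s')) s'
      ≤ ∫⁻ s' in Set.Ioc 0 s, ∫⁻ τ in Set.Ioc s' ((L : ℝ) * s), F τ (τ - s') := by
    rw [lintegral_lintegral_swap hG.aemeasurable]
    refine lintegral_mono fun s' => ?_
    rw [← lintegral_indicator measurableSet_Ioc, ← lintegral_indicator measurableSet_Ioc]
    refine lintegral_mono fun τ => ?_
    simp only [Set.indicator, Set.mem_Ioc, Set.mem_Iio]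
    split_ifs <;> first | exact le_rfl | exact bot_le | (exfalso; grind)
  have hconst : ENNReal.ofReal (2 / s) = ENNReal.ofReal (1 / s) * 2 := by
    rw [← ENNReal.ofReal_ofNat 2, ← ENNReal.ofReal_mul (by positivity)]
    congr 1
    ring
  rw [← Finset.mul_sum, hconst, mul_assoc]
  gcongr
  refine (Finset.sum_le_sum hblock).trans ?_
  rw [← Finset.mul_sum, sum_lintegral_Ioc_consecutive hs.le]
  gcongr
end
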